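/- arXiv:1710.01554 — 2 statements merged into one kernel-verified Lean document; each statement's English description precedes it below -/
import Mathlib

section
/- Let (X₁, ..., Xₙ) follow the Curie-Weiss joint law dP_{n,β} with base measure ρ of mean 0 and variance 1, and let S_n = X₁ + ... + Xₙ. (i) If β = 1, ρ is of type k with strength λ_ρ > 0, and there are constants b₀ > 0, b₁ > 0, b₂ > 1 with ∫ e^{tx} dρ(x) ≤ exp(t²/2 − b₁ t^{2k}) for |t| ≤ b₀ and ∫ e^{tx} dρ(x) ≤ exp(t²/(2b₂)) for |t| > b₀, then there is a constant C such that E( (S_n / n^{1 − 1/(2k)})^{2k} ) ≤ C. (ii) If 0 < β < 1 and there is b > β with ∫ e^{tx} dρ(x) ≤ e^{t²/(2b)} for all real t, then there is a constant C such that E( (S_n/√n)² ) ≤ C. -/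
open MeasureTheory ProbabilityTheory Filter Set

/-- The Curie–Weiss joint law `dP_{n,β}(x) = Zₙ⁻¹ exp(β (x₁+⋯+xₙ)²/(2n)) ∏ᵢ dρ(xᵢ)`. -/
noncomputable def cwMeasure (ρ : Measure ℝ) (β : ℝ) (n : ℕ) : Measure (Fin n → ℝ) :=
  (Measure.pi fun _ : Fin n => ρ).withDensity fun x =>
    ENNReal.ofReal (Real.exp (β * (∑ i, x i) ^ 2 / (2 * n)) /
      ∫ y, Real.exp (β * (∑ i, y i) ^ 2 / (2 * n)) ∂(Measure.pi fun _ : Fin n => ρ))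


namespace CWAux

lemma cw_reduce {n : ℕ} (ρ : Measure ℝ) [IsProbabilityMeasure ρ] (β : ℝ)
    (f : (Fin n → ℝ) → ℝ) (hf : Measurable f) (hf0 : ∀ x, 0 ≤ f x) (C : ℝ) (hC : 0 ≤ C)
    (h : Integrable (fun x : Fin n → ℝ => Real.exp (β * (∑ i, x i) ^ 2 / (2 * n)))
        (Measure.pi fun _ : Fin n => ρ) →
      ∫⁻ x, ENNReal.ofReal (f x * Real.exp (β * (∑ i, x i) ^ 2 / (2 * n)))
          ∂(Measure.pi fun _ : Fin n => ρ) ≤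
        ENNReal.ofReal C * ∫⁻ x, ENNReal.ofReal (Real.exp (β * (∑ i, x i) ^ 2 / (2 * n)))
          ∂(Measure.pi fun _ : Fin n => ρ)) :
    ∫ x, f x ∂(cwMeasure ρ β n) ≤ C := by
  set μ := Measure.pi fun _ : Fin n => ρ with hμ
  set e : (Fin n → ℝ) → ℝ := fun x => Real.exp (β * (∑ i, x i) ^ 2 / (2 * n)) with he
  have hem : Measurable e := by fun_prop
  have hcw : cwMeasure ρ β n = μ.withDensity fun x => ENNReal.ofReal (e x / ∫ y, e y ∂μ) := rfl
  by_cases hi : Integrable e μ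
  · have h := h hi
    set Z := ∫ y, e y ∂μ with hZ
    have hZpos : 0 < Z := by
      apply integral_exp_pos hi
    have hZl : ENNReal.ofReal Z = ∫⁻ x, ENNReal.ofReal (e x) ∂μ :=
      ofReal_integral_eq_lintegral_ofReal hi (Eventually.of_forall fun x => (Real.exp_pos _).le)
    rw [integral_eq_lintegral_of_nonneg_ae (Eventually.of_forall hf0) hf.aestronglyMeasurable, hcw]
    apply ENNReal.toReal_le_of_le_ofReal hC
    rw [lintegral_withDensity_eq_lintegral_mul _ (by fun_prop) (by fun_prop)]
    have : ∀ x, ((fun x => ENNReal.ofReal (e x / Z)) * fun x => ENNReal.ofReal (f x)) x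
        = ENNReal.ofReal Z⁻¹ * ENNReal.ofReal (f x * e x) := by
      intro x
      have := (Real.exp_pos (β * (∑ i, x i) ^ 2 / (2 * n))).le
      simp only [Pi.mul_apply]
      rw [← ENNReal.ofReal_mul (by positivity), ← ENNReal.ofReal_mul (by positivity)]
      congr 1; rw [div_eq_mul_inv]; ring
    rw [lintegral_congr this, lintegral_const_mul _ (by fun_prop)]
    calc _ ≤ ENNReal.ofReal Z⁻¹ * (ENNReal.ofReal C * ENNReal.ofReal Z) := by
            rw [hZl]; gcongr
      _ = ENNReal.ofReal C := by
            rw [← ENNReal.ofReal_mul hC, ← ENNReal.ofReal_mul (by positivity)]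
            congr 1; field_simp
  · have : cwMeasure ρ β n = 0 := by
      rw [hcw, integral_undef hi]; simp
    rw [this]; simpa using hC

lemma lint_prod {n : ℕ} (ρ : Measure ℝ) [IsProbabilityMeasure ρ] (t : ℝ) :
    ∫⁻ x, ENNReal.ofReal (Real.exp (t * ∑ i, x i)) ∂(Measure.pi fun _ : Fin n => ρ)
      = (∫⁻ x, ENNReal.ofReal (Real.exp (t * x)) ∂ρ) ^ n := by
  have h1 : ∀ x : Fin n → ℝ, ENNReal.ofReal (Real.exp (t * ∑ i, x i))
      = ∏ i, ENNReal.ofReal (Real.exp (t * x i)) := by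
    intro x
    rw [← ENNReal.ofReal_prod_of_nonneg (fun i _ => (Real.exp_pos _).le), ← Real.exp_sum,
      Finset.mul_sum]
  rw [lintegral_congr h1]
  have hind := iIndepFun_pi (μ := fun _ : Fin n => ρ)
    (X := fun _ x => ENNReal.ofReal (Real.exp (t * x))) (fun i => by fun_prop)
  rw [lintegral_prod_eq_prod_lintegral_of_indepFun Finset.univ _ hind (fun i => by fun_prop)]
  have h2 : ∀ i : Fin n, ∫⁻ x : Fin n → ℝ, ENNReal.ofReal (Real.exp (t * x i))
      ∂(Measure.pi fun _ : Fin n => ρ) = ∫⁻ x, ENNReal.ofReal (Real.exp (t * x)) ∂ρ := fun i =>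
    (measurePreserving_eval (fun _ : Fin n => ρ) i).lintegral_comp
      (f := fun x => ENNReal.ofReal (Real.exp (t * x))) (by fun_prop)
  simp [h2]

lemma exp_integrable {n : ℕ} (hn : 0 < n) (ρ : Measure ℝ) [IsProbabilityMeasure ρ] (β : ℝ)
    (hβ : 0 < β)
    (hi : Integrable (fun x : Fin n → ℝ => Real.exp (β * (∑ i, x i) ^ 2 / (2 * n)))
        (Measure.pi fun _ : Fin n => ρ)) (t : ℝ) :
    Integrable (fun x => Real.exp (t * x)) ρ := by
  have hn' : (0 : ℝ) < n := by exact_mod_cast hn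
  have h1 : Integrable (fun x : Fin n → ℝ => Real.exp (t * ∑ i, x i))
      (Measure.pi fun _ : Fin n => ρ) := by
    refine (hi.const_mul (Real.exp (n * t ^ 2 / (2 * β)))).mono' (by fun_prop)
      (Eventually.of_forall fun x => ?_)
    rw [Real.norm_of_nonneg (Real.exp_pos _).le, ← Real.exp_add]
    apply Real.exp_le_exp.2
    set s := ∑ i, x i
    have : n * t ^ 2 / (2 * β) + β * s ^ 2 / (2 * n) - t * s
        = (n * t - β * s) ^ 2 / (2 * β * n) := by field_simp; ring
    have : 0 ≤ (n * t - β * s) ^ 2 / (2 * β * n) := by positivity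
    linarith
  have h2 := h1.lintegral_lt_top
  rw [lint_prod] at h2
  have h3 : ∫⁻ x, ENNReal.ofReal (Real.exp (t * x)) ∂ρ ≠ ⊤ := by
    intro h; rw [h, ENNReal.top_pow hn.ne'] at h2; exact lt_irrefl _ h2
  exact (lintegral_ofReal_ne_top_iff_integrable (by fun_prop)
    (Eventually.of_forall fun x => (Real.exp_pos _).le)).1 h3

/-- Hubbard–Stratonovich. -/
lemma hs (v : NNReal) (s : ℝ) : ENNReal.ofReal (Real.exp (v * s ^ 2 / 2)) =
    ∫⁻ t, ENNReal.ofReal (Real.exp (t * s)) ∂(gaussianReal 0 v) := by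
  have := congrFun (mgf_id_gaussianReal (μ := 0) (v := v)) s
  simp only [mgf, id, zero_mul, zero_add] at this
  rw [← this, ofReal_integral_eq_lintegral_ofReal (integrable_exp_mul_gaussianReal s)
    (Eventually.of_forall fun x => (Real.exp_pos _).le)]
  simp [mul_comm]

lemma gauss_lint {v : NNReal} (hv : v ≠ 0) (m : ℝ) (F : ℝ → ENNReal) (hF : Measurable F) :
    ∫⁻ t, F t ∂(gaussianReal m v) =
      ∫⁻ t, ENNReal.ofReal ((√(2 * Real.pi * v))⁻¹ * Real.exp (-(t - m) ^ 2 / (2 * v))) * F t := by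
  rw [gaussianReal_of_var_ne_zero _ hv, lintegral_withDensity_eq_lintegral_mul _
    (measurable_gaussianPDF _ _) hF]
  rfl

/-- tilted Jensen. -/
lemma hs_moment {v : NNReal} (hv : v ≠ 0) (k : ℕ) (s : ℝ) :
    ENNReal.ofReal ((v * s) ^ (2 * k) * Real.exp (v * s ^ 2 / 2)) ≤
    ∫⁻ t, ENNReal.ofReal (t ^ (2 * k)) * ENNReal.ofReal (Real.exp (t * s)) ∂(gaussianReal 0 v) := by
  have hv' : (0 : ℝ) < v := by positivity
  have hi : Integrable (fun t : ℝ => t ^ (2 * k)) (gaussianReal (v * s) v) := by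
    have := integrable_pow_of_integrable_exp_mul (X := id) (μ := gaussianReal (v * s) v)
      (t := 1) one_ne_zero
      (integrable_exp_mul_gaussianReal 1) (integrable_exp_mul_gaussianReal (-1)) (2 * k)
    simpa using this
  have hid : Integrable (fun t : ℝ => t) (gaussianReal (v * s) v) := by
    have := integrable_pow_of_integrable_exp_mul (X := id) (μ := gaussianReal (v * s) v)
      (t := 1) one_ne_zero
      (integrable_exp_mul_gaussianReal 1) (integrable_exp_mul_gaussianReal (-1)) 1
    simpa using this
  have hJ : (v * s : ℝ) ^ (2 * k) ≤ ∫ t, t ^ (2 * k) ∂(gaussianReal (v * s) v) := by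
    have hc : ConvexOn ℝ Set.univ (fun t : ℝ => t ^ (2 * k)) := (even_two_mul k).convexOn_pow
    have := hc.map_integral_le (μ := gaussianReal (v * s) v) (f := fun t => t)
      (by fun_prop) isClosed_univ (by simp) hid hi
    simpa using this
  have hev : ∀ t : ℝ, 0 ≤ t ^ (2 * k) := fun t => (even_two_mul k).pow_nonneg t
  calc _ = ENNReal.ofReal (Real.exp (v * s ^ 2 / 2)) * ENNReal.ofReal ((v * s) ^ (2 * k)) := by
        rw [mul_comm, ENNReal.ofReal_mul (Real.exp_pos _).le]
    _ ≤ ENNReal.ofReal (Real.exp (v * s ^ 2 / 2)) *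
        ∫⁻ t, ENNReal.ofReal (t ^ (2 * k)) ∂(gaussianReal (v * s) v) := by
        gcongr
        rw [← ofReal_integral_eq_lintegral_ofReal hi (Eventually.of_forall hev)]
        exact ENNReal.ofReal_le_ofReal hJ
    _ = _ := by
        rw [gauss_lint hv _ _ (by fun_prop), gauss_lint hv _ _ (by fun_prop),
          ← lintegral_const_mul _ (by fun_prop)]
        apply lintegral_congr
        intro t
        have := hev t
        rw [← ENNReal.ofReal_mul (by positivity), ← ENNReal.ofReal_mul (by positivity),
          ← ENNReal.ofReal_mul (by positivity), ← ENNReal.ofReal_mul (by positivity)]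
        congr 1
        have : Real.exp (v * s ^ 2 / 2) * Real.exp (-(t - v * s) ^ 2 / (2 * v))
          = Real.exp (-(t - 0) ^ 2 / (2 * v)) * Real.exp (t * s) := by
          rw [← Real.exp_add, ← Real.exp_add]; congr 1; field_simp; ring
        linear_combination ((√(2 * Real.pi * v))⁻¹ * t ^ (2 * k)) * this

lemma taylor_sign (n : ℕ) : ∀ x : ℝ, x ≤ 0 →
    0 ≤ (-1) ^ n * (Real.exp x - ∑ j ∈ Finset.range n, x ^ j / j.factorial) := by
  induction n with
  | zero => intro x _; simpa using (Real.exp_pos x).le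
  | succ n ih =>
    intro x hx
    set g : ℝ → ℝ := fun x =>
      (-1) ^ (n + 1) * (Real.exp x - ∑ j ∈ Finset.range (n + 1), x ^ j / j.factorial) with hg
    have hd : ∀ y, HasDerivAt g
        ((-1) ^ (n + 1) * (Real.exp y - ∑ j ∈ Finset.range n, y ^ j / j.factorial)) y := by
      intro y
      apply HasDerivAt.const_mul
      apply (Real.hasDerivAt_exp y).sub
      have : ∀ j ∈ Finset.range (n + 1), HasDerivAt (fun x : ℝ => x ^ j / j.factorial)
          (j * y ^ (j - 1) / j.factorial) y := fun j _ => (hasDerivAt_pow j y).div_const _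
      have h := HasDerivAt.fun_sum this
      convert h using 1
      rw [Finset.sum_range_succ']
      simp only [Nat.cast_zero, zero_mul, zero_div, add_zero]
      apply Finset.sum_congr rfl
      intro j _
      rw [Nat.factorial_succ]; push_cast
      have : (j.factorial : ℝ) ≠ 0 := by positivity
      field_simp
    have hanti : AntitoneOn g (Set.Iic 0) := by
      apply antitoneOn_of_deriv_nonpos (convex_Iic 0)
      · exact fun y _ => (hd y).continuousAt.continuousWithinAt
      · exact fun y _ => (hd y).differentiableAt.differentiableWithinAt
      · intro y hy
        rw [interior_Iic] at hy
        rw [(hd y).deriv, pow_succ]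
        have := ih y (le_of_lt hy)
        linarith
    have h0 : g 0 = 0 := by
      simp [hg, Finset.sum_range_succ']
    have := hanti (Set.mem_Iic.2 hx) (Set.mem_Iic.2 le_rfl) hx
    rw [h0] at this
    exact this

lemma taylor_le (k : ℕ) (x : ℝ) : ∑ j ∈ Finset.range (2 * k), x ^ j / j.factorial ≤ Real.exp x := by
  rcases le_total 0 x with h | h
  · exact Real.sum_le_exp_of_nonneg h _
  · have := taylor_sign (2 * k) x h
    rw [(even_two_mul k).neg_one_pow] at this
    linarith

lemma taylor_ge (k : ℕ) (x : ℝ) :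
    Real.exp x - ∑ j ∈ Finset.range (2 * k), x ^ j / j.factorial ≤ |x| ^ (2 * k) * Real.exp |x| := by
  have := Complex.norm_exp_sub_sum_le_norm_mul_exp (x : ℂ) (2 * k)
  have h2 : Complex.exp x - ∑ j ∈ Finset.range (2 * k), (x : ℂ) ^ j / j.factorial
     = ((Real.exp x - ∑ j ∈ Finset.range (2 * k), x ^ j / j.factorial : ℝ) : ℂ) := by push_cast; rfl
  rw [h2, Complex.norm_real, Complex.norm_real] at this
  exact (le_abs_self _).trans this

lemma lower_mgf (ρ : Measure ℝ) [IsProbabilityMeasure ρ] (k : ℕ)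
    (hm : ∀ j : ℕ, j < 2 * k → (∫ x, x ^ j ∂(gaussianReal 0 1)) - ∫ x, x ^ j ∂ρ = 0) :
    ∃ C : ℝ, 1 ≤ C ∧ ((∀ t, Integrable (fun x => Real.exp (t * x)) ρ) →
      ∀ t : ℝ, |t| ≤ 1 →
      Real.exp (t ^ 2 / 2) - C * t ^ (2 * k) ≤ ∫ x, Real.exp (t * x) ∂ρ) := by
  set γ := gaussianReal 0 1
  have hγ : ∀ t, Integrable (fun x => Real.exp (t * x)) γ := integrable_exp_mul_gaussianReal
  have hγi : Integrable (fun x : ℝ => |x| ^ (2 * k) * Real.exp (1 * x) + |x| ^ (2 * k) * Real.exp (-1 * x)) γ :=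
    (integrable_pow_abs_mul_exp_of_integrable_exp_mul (X := id) one_ne_zero (hγ _) (hγ _) _).add
     (integrable_pow_abs_mul_exp_of_integrable_exp_mul (X := id) one_ne_zero (hγ _) (hγ _) _)
  refine ⟨max 1 (∫ x, (|x| ^ (2 * k) * Real.exp (1 * x) + |x| ^ (2 * k) * Real.exp (-1 * x)) ∂γ),
    le_max_left _ _, fun hρ t ht => ?_⟩
  set D := ∫ x, (|x| ^ (2 * k) * Real.exp (1 * x) + |x| ^ (2 * k) * Real.exp (-1 * x)) ∂γ
  have hpow : ∀ (ν : Measure ℝ), (∀ t, Integrable (fun x => Real.exp (t * x)) ν) → ∀ j : ℕ,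
      Integrable (fun x : ℝ => (t * x) ^ j / j.factorial) ν := by
    intro ν hν j
    have := integrable_pow_of_integrable_exp_mul (X := id) (μ := ν) (t := 1) one_ne_zero
      (hν 1) (hν (-1)) j
    simp only [mul_pow, mul_div_assoc]
    exact (this.div_const _).const_mul _
  have hP : ∫ x, ∑ j ∈ Finset.range (2 * k), (t * x) ^ j / j.factorial ∂ρ
      = ∫ x, ∑ j ∈ Finset.range (2 * k), (t * x) ^ j / j.factorial ∂γ := by
    rw [integral_finsetSum _ (fun j _ => hpow ρ hρ j), integral_finsetSum _ (fun j _ => hpow γ hγ j)]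
    apply Finset.sum_congr rfl
    intro j hj
    simp only [mul_pow, mul_div_assoc]
    rw [integral_const_mul, integral_const_mul, integral_div, integral_div]
    have := hm j (Finset.mem_range.1 hj)
    rw [sub_eq_zero.1 this]
  have h1 : ∫ x, ∑ j ∈ Finset.range (2 * k), (t * x) ^ j / j.factorial ∂ρ
      ≤ ∫ x, Real.exp (t * x) ∂ρ :=
    integral_mono (integrable_finsetSum _ fun j _ => hpow ρ hρ j) (hρ t) (fun x => taylor_le k _)
  have h2 : ∫ x, Real.exp (t * x) ∂γ = Real.exp (t ^ 2 / 2) := by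
    have := congrFun (mgf_id_gaussianReal (μ := 0) (v := 1)) t
    simpa [mgf] using this
  have hev : ∀ t : ℝ, 0 ≤ t ^ (2 * k) := fun t => (even_two_mul k).pow_nonneg t
  have h3 : ∫ x, Real.exp (t * x) ∂γ - ∫ x, ∑ j ∈ Finset.range (2 * k), (t * x) ^ j / j.factorial ∂γ
      ≤ t ^ (2 * k) * D := by
    rw [← integral_sub (hγ t) (integrable_finsetSum _ fun j _ => hpow γ hγ j), ← integral_const_mul]
    apply integral_mono ((hγ t).sub (integrable_finsetSum _ fun j _ => hpow γ hγ j))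
      (hγi.const_mul _)
    intro x
    refine (taylor_ge k (t * x)).trans ?_
    simp only
    have e1 : Real.exp |t * x| ≤ Real.exp (1 * x) + Real.exp (-1 * x) := by
      have : |t * x| ≤ |x| := by
        rw [abs_mul]; exact mul_le_of_le_one_left (abs_nonneg _) ht
      refine (Real.exp_le_exp.2 this).trans ?_
      rcases abs_cases x with ⟨h, _⟩ | ⟨h, _⟩ <;> rw [h] <;> simp [(Real.exp_pos _).le]
    rw [abs_mul] at e1
    rw [abs_mul, mul_pow, (even_two_mul k).pow_abs t, mul_assoc, ← mul_add]
    have := hev t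
    gcongr
  have := mul_le_mul_of_nonneg_left (le_max_right 1 D) (hev t)
  rw [hP] at h1
  linarith

lemma expect_hs {n : ℕ} (ρ : Measure ℝ) [IsProbabilityMeasure ρ] (v : NNReal) :
    ∫⁻ x, ENNReal.ofReal (Real.exp (v * (∑ i, x i) ^ 2 / 2)) ∂(Measure.pi fun _ : Fin n => ρ)
      = ∫⁻ t, (∫⁻ x, ENNReal.ofReal (Real.exp (t * x)) ∂ρ) ^ n ∂(gaussianReal 0 v) := by
  simp only [hs, ← lint_prod]
  rw [lintegral_lintegral_swap]
  fun_prop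

lemma expect_hs_moment {n : ℕ} (ρ : Measure ℝ) [IsProbabilityMeasure ρ] {v : NNReal} (hv : v ≠ 0)
    (k : ℕ) :
    ∫⁻ x, ENNReal.ofReal ((v * (∑ i, x i)) ^ (2 * k) * Real.exp (v * (∑ i, x i) ^ 2 / 2))
        ∂(Measure.pi fun _ : Fin n => ρ)
      ≤ ∫⁻ t, ENNReal.ofReal (t ^ (2 * k)) * (∫⁻ x, ENNReal.ofReal (Real.exp (t * x)) ∂ρ) ^ n
        ∂(gaussianReal 0 v) := by
  have hmono : ∀ x : Fin n → ℝ, ENNReal.ofReal ((v * (∑ i, x i)) ^ (2 * k) *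
      Real.exp (v * (∑ i, x i) ^ 2 / 2)) ≤ ∫⁻ t, ENNReal.ofReal (t ^ (2 * k)) *
        ENNReal.ofReal (Real.exp (t * ∑ i, x i)) ∂(gaussianReal 0 v) :=
    fun x => hs_moment hv k (∑ i, x i)
  refine (lintegral_mono hmono).trans ?_
  rw [lintegral_lintegral_swap]
  swap
  · apply Measurable.aemeasurable
    unfold Function.uncurry
    fun_prop
  apply le_of_eq
  apply lintegral_congr
  intro t
  rw [lintegral_const_mul _ (by fun_prop), lint_prod]

lemma part_two (ρ : Measure ℝ) [IsProbabilityMeasure ρ] (β b : ℝ) (hβ : 0 < β) (hb : β < b)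
    (hM : ∀ t : ℝ, ∫ x, Real.exp (t * x) ∂ρ ≤ Real.exp (t ^ 2 / (2 * b))) :
    ∃ C : ℝ, 0 < C ∧ ∀ n : ℕ, 0 < n →
      (∫ x, ((∑ i, x i) / Real.sqrt n) ^ 2 ∂(cwMeasure ρ β n)) ≤ C := by
  obtain ⟨c, hc1, hc2⟩ := exists_between hb
  have hc0 : 0 < c := hβ.trans hc1
  have hb0 : 0 < b := hβ.trans hb
  set c' : NNReal := ⟨c, hc0.le⟩ with hc'
  have hcc : (c' : ℝ) = c := rfl
  have hc'0 : c' ≠ 0 := by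
    intro h; apply hc0.ne'; rw [← hcc, h]; rfl
  set D := ∫⁻ t, ENNReal.ofReal (Real.exp (t ^ 2 / (2 * b))) ∂(gaussianReal 0 c') with hD
  have hDfin : D ≠ ⊤ := by
    rw [hD, gauss_lint hc'0 _ _ (by fun_prop)]
    have hpos : 0 < 1 / (2 * c) - 1 / (2 * b) := by
      rw [sub_pos]; apply one_div_lt_one_div_of_lt <;> linarith
    have hint := (integrable_exp_neg_mul_sq hpos).const_mul (√(2 * Real.pi * c))⁻¹
    convert hint.lintegral_lt_top.ne using 1
    apply lintegral_congr
    intro t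
    rw [← ENNReal.ofReal_mul (by positivity), mul_assoc, ← Real.exp_add, hcc]
    congr 3; field_simp; ring
  have hscale : ∀ n : ℕ, 0 < n →
      ∫⁻ t, ENNReal.ofReal (Real.exp (n * t ^ 2 / (2 * b))) ∂(gaussianReal 0 (c' / n)) = D := by
    intro n hn
    have hn' : (0 : ℝ) < n := by exact_mod_cast hn
    have hmap := gaussianReal_map_div_const (μ := 0) (v := c') (√(n : ℝ))
    have h0 : (gaussianReal 0 c').map (fun x => x / √(n : ℝ)) = gaussianReal 0 (c' / n) := by
      rw [hmap]
      congr 1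
      · simp
      · apply NNReal.eq; simp
    rw [← h0, lintegral_map (by fun_prop) (by fun_prop)]
    apply lintegral_congr
    intro t
    rw [div_pow, Real.sq_sqrt hn'.le]
    congr 3; field_simp
  set K := 2 / (c - β) with hK
  have hcb : 0 < c - β := by linarith
  have hK0 : 0 < K := by positivity
  refine ⟨K * D.toReal + 1, by positivity, fun n hn => ?_⟩
  have hn' : (0 : ℝ) < n := by exact_mod_cast hn
  apply cw_reduce ρ β _ (by fun_prop) (fun x => sq_nonneg _) _ (by positivity)
  intro hi
  have hexp := exp_integrable hn ρ β hβ hi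
  have hone : (1 : ENNReal) ≤ ∫⁻ x, ENNReal.ofReal (Real.exp (β * (∑ i, x i) ^ 2 / (2 * n)))
          ∂(Measure.pi fun _ : Fin n => ρ) := by
    calc (1 : ENNReal) = ∫⁻ x, 1 ∂(Measure.pi fun _ : Fin n => ρ) := by simp
      _ ≤ _ := by
        apply lintegral_mono
        intro x
        simp only [ENNReal.one_le_ofReal]
        apply Real.one_le_exp; positivity
  refine le_trans ?_ (le_mul_of_one_le_right' hone)
  calc _ ≤ ∫⁻ x, ENNReal.ofReal K *
          ENNReal.ofReal (Real.exp ((c' / n : NNReal) * (∑ i, x i) ^ 2 / 2))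
          ∂(Measure.pi fun _ : Fin n => ρ) := by
        apply lintegral_mono
        intro x
        simp only
        rw [← ENNReal.ofReal_mul hK0.le]
        apply ENNReal.ofReal_le_ofReal
        set s := ∑ i, x i
        rw [div_pow, Real.sq_sqrt hn'.le]
        have h1 : s ^ 2 / n ≤ K * Real.exp ((c - β) * (s ^ 2 / n) / 2) := by
          have := Real.add_one_le_exp ((c - β) * (s ^ 2 / n) / 2)
          have h2 : s ^ 2 / n = K * ((c - β) * (s ^ 2 / n) / 2) := by
            rw [hK]; field_simp
          rw [h2]
          apply mul_le_mul_of_nonneg_left _ hK0.le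
          rw [← h2]; linarith
        calc _ ≤ (K * Real.exp ((c - β) * (s ^ 2 / n) / 2)) * Real.exp (β * s ^ 2 / (2 * n)) := by
              gcongr
          _ = _ := by
              rw [mul_assoc, ← Real.exp_add]; congr 2; push_cast; rw [hcc]; field_simp; ring
    _ = ENNReal.ofReal K * ∫⁻ t, (∫⁻ x, ENNReal.ofReal (Real.exp (t * x)) ∂ρ) ^ n
          ∂(gaussianReal 0 (c' / n)) := by
        rw [lintegral_const_mul _ (by fun_prop), expect_hs]
    _ ≤ ENNReal.ofReal K * D := by
        rw [← hscale n hn]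
        gcongr with t
        rw [← ofReal_integral_eq_lintegral_ofReal (hexp t)
          (Eventually.of_forall fun x => (Real.exp_pos _).le), mul_div_assoc, Real.exp_nat_mul,
          ENNReal.ofReal_pow (Real.exp_pos _).le]
        gcongr
        exact hM t
    _ ≤ _ := by
        rw [← ENNReal.ofReal_toReal hDfin, ← ENNReal.ofReal_mul hK0.le,
          ENNReal.toReal_ofReal ENNReal.toReal_nonneg]
        apply ENNReal.ofReal_le_ofReal; linarith

lemma poly_exp_bound (k : ℕ) (c : ℝ) (hc : 0 < c) : ∃ K : ℝ, 0 < K ∧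
    ∀ u : ℝ, u ^ (2 * k) * Real.exp (-c * |u|) ≤ K * (1 + u ^ 2)⁻¹ := by
  have key : ∀ (j : ℕ) (u : ℝ), u ^ (2 * j) * Real.exp (-c * |u|)
      ≤ (2 * j).factorial / c ^ (2 * j) := by
    intro j u
    have := Real.pow_div_factorial_le_exp (c * |u|) (by positivity) (2 * j)
    rw [mul_pow, (even_two_mul j).pow_abs, div_le_iff₀ (by positivity)] at this
    rw [le_div_iff₀ (by positivity), neg_mul, Real.exp_neg]
    have he := Real.exp_pos (c * |u|)
    rw [mul_right_comm, ← div_eq_mul_inv, div_le_iff₀ he]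
    linarith
  refine ⟨(2 * k).factorial / c ^ (2 * k) + (2 * (k + 1)).factorial / c ^ (2 * (k + 1)),
    by positivity, fun u => ?_⟩
  rw [← div_eq_mul_inv, le_div_iff₀ (by positivity)]
  have h1 := key k u
  have h2 := key (k + 1) u
  have : u ^ (2 * (k + 1)) = u ^ (2 * k) * u ^ 2 := by ring
  rw [this] at h2
  linarith

lemma part_one (ρ : Measure ℝ) [IsProbabilityMeasure ρ] (k : ℕ) (hk : 1 ≤ k)
    (hm : ∀ j : ℕ, j < 2 * k → (∫ x, x ^ j ∂(gaussianReal 0 1)) - ∫ x, x ^ j ∂ρ = 0)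
    (b₀ b₁ b₂ : ℝ) (hb₀ : 0 < b₀) (hb₁ : 0 < b₁) (hb₂ : 1 < b₂)
    (hM1 : ∀ t : ℝ, |t| ≤ b₀ →
        ∫ x, Real.exp (t * x) ∂ρ ≤ Real.exp (t ^ 2 / 2 - b₁ * t ^ (2 * k)))
    (hM2 : ∀ t : ℝ, b₀ < |t| →
        ∫ x, Real.exp (t * x) ∂ρ ≤ Real.exp (t ^ 2 / (2 * b₂))) :
    ∃ C : ℝ, 0 < C ∧ ∀ n : ℕ, 0 < n →
          (∫ x, ((∑ i, x i) / (n : ℝ) ^ (1 - 1 / (2 * (k : ℝ)))) ^ (2 * k)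
            ∂(cwMeasure ρ 1 n)) ≤ C := by
  have hev : ∀ t : ℝ, 0 ≤ t ^ (2 * k) := fun t => (even_two_mul k).pow_nonneg t
  obtain ⟨A, hA1, hA⟩ := lower_mgf ρ k hm
  have hA0 : 0 < A := by linarith
  set d := (1 - 1 / b₂) / 2 with hd
  have hd0 : 0 < d := by
    have : 1 / b₂ < 1 := by rw [div_lt_one (by linarith)]; exact hb₂
    rw [hd]; linarith
  set c := min b₁ (d * b₀) with hc
  have hc0 : 0 < c := lt_min hb₁ (by positivity)
  obtain ⟨K, hK0, hK⟩ := poly_exp_bound k c hc0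
  refine ⟨4 * A * (Real.exp b₁ * K * Real.pi), by positivity, fun n hn => ?_⟩
  have hn' : (0 : ℝ) < n := by exact_mod_cast hn
  have hn1 : (1 : ℝ) ≤ n := by exact_mod_cast hn
  have hk' : (0 : ℝ) < k := by exact_mod_cast hk
  -- the scale
  set a : ℝ := (n : ℝ) ^ (1 / (2 * (k : ℝ))) with ha
  have ha0 : 0 < a := by positivity
  have ha1 : 1 ≤ a := Real.one_le_rpow hn1 (by positivity)
  have hapow : a ^ (2 * k) = n := by
    rw [ha, ← Real.rpow_natCast, ← Real.rpow_mul hn'.le]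
    push_cast
    rw [one_div_mul_cancel (by positivity), Real.rpow_one]
  have han : a ≤ n := by
    rw [← hapow]; exact le_self_pow₀ ha1 (by omega)
  have hna : (n : ℝ) ^ (1 - 1 / (2 * (k : ℝ))) = n / a := by
    rw [Real.rpow_sub hn', Real.rpow_one]
  apply cw_reduce ρ 1 _ (by fun_prop) (fun x => hev _) _ (by positivity)
  intro hi
  have hexp := exp_integrable hn ρ 1 one_pos hi
  set M : ℝ → ℝ := fun t => ∫ x, Real.exp (t * x) ∂ρ with hMdef
  have hMnn : ∀ t, 0 ≤ M t := fun t => integral_nonneg fun x => (Real.exp_pos _).le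
  have hml : ∀ t, ∫⁻ x, ENNReal.ofReal (Real.exp (t * x)) ∂ρ = ENNReal.ofReal (M t) := fun t =>
    (ofReal_integral_eq_lintegral_ofReal (hexp t)
          (Eventually.of_forall fun x => (Real.exp_pos _).le)).symm
  have hMmeas : Measurable fun t => ENNReal.ofReal (M t) := by
    simp only [← hml]
    exact Measurable.lintegral_prod_right' (f := fun p : ℝ × ℝ => ENNReal.ofReal (Real.exp (p.1 * p.2)))
      (by fun_prop)
  set v : NNReal := 1 / n with hv
  have hv0 : v ≠ 0 := by
    rw [hv]; positivity
  have hvr : (v : ℝ) = 1 / n := by rw [hv]; push_cast; rfl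
  set G : ℝ → ℝ := fun t => M t * Real.exp (-(t ^ 2 / 2)) with hG
  have hGnn : ∀ t, 0 ≤ G t := fun t => mul_nonneg (hMnn t) (Real.exp_pos _).le
  set q : ℝ := (√(2 * Real.pi * v))⁻¹ with hq
  have hq0 : 0 < q := by
    rw [hq, hvr]; positivity
  have hdens : ∀ t, ENNReal.ofReal (q * Real.exp (-(t - 0) ^ 2 / (2 * v))) * ENNReal.ofReal (M t) ^ n
      = ENNReal.ofReal (q * G t ^ n) := by
    intro t
    rw [← ENNReal.ofReal_pow (hMnn t), ← ENNReal.ofReal_mul (by positivity)]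
    congr 1
    rw [hG]
    simp only
    rw [mul_pow, ← Real.exp_nat_mul, hvr]
    have : -(t - 0) ^ 2 / (2 * (1 / n : ℝ)) = n * -(t ^ 2 / 2) := by field_simp; ring
    rw [this]; ring
  -- lower bound for the partition function
  set δ : ℝ := 1 / (a * (2 * A)) with hδ
  have hδ0 : 0 < δ := by positivity
  have hlow : ENNReal.ofReal (q / (4 * A * a)) ≤
      ∫⁻ x, ENNReal.ofReal (Real.exp (1 * (∑ i, x i) ^ 2 / (2 * n)))
          ∂(Measure.pi fun _ : Fin n => ρ) := by
    have e1 : ∀ x : Fin n → ℝ, Real.exp (1 * (∑ i, x i) ^ 2 / (2 * n))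
        = Real.exp (v * (∑ i, x i) ^ 2 / 2) := by
      intro x; rw [hvr]; congr 1; field_simp
    simp only [e1]
    rw [expect_hs]
    simp only [hml]
    rw [gauss_lint hv0 _ _ (hMmeas.pow_const n)]
    simp only [← hq, hdens]
    calc ENNReal.ofReal (q / (4 * A * a)) = ∫⁻ t in Set.Icc 0 δ, ENNReal.ofReal (q * (1 / 2)) := by
          rw [setLIntegral_const, Real.volume_Icc, ← ENNReal.ofReal_mul (by positivity)]
          congr 1; rw [hδ]; field_simp; ring
      _ ≤ ∫⁻ t in Set.Icc 0 δ, ENNReal.ofReal (q * G t ^ n) := by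
          apply setLIntegral_mono' measurableSet_Icc
          intro t ht
          apply ENNReal.ofReal_le_ofReal
          apply mul_le_mul_of_nonneg_left _ hq0.le
          have htδ : t ^ (2 * k) ≤ 1 / (n * (2 * A)) := by
            calc t ^ (2 * k) ≤ δ ^ (2 * k) := pow_le_pow_left₀ ht.1 ht.2 _
              _ = 1 / (n * (2 * A) ^ (2 * k)) := by
                rw [hδ, div_pow, one_pow, mul_pow, hapow]
              _ ≤ _ := by
                apply one_div_le_one_div_of_le (by positivity)
                gcongr
                exact le_self_pow₀ (by linarith) (by omega)
          have hδ1 : δ ≤ 1 := by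
            rw [hδ, div_le_one (by positivity)]; nlinarith
          have ht1 : |t| ≤ 1 := by rw [abs_of_nonneg ht.1]; exact ht.2.trans hδ1
          have hGl : 1 - A * t ^ (2 * k) ≤ G t := by
            have h := hA hexp t ht1
            have hpos := Real.exp_pos (-(t ^ 2 / 2))
            have h' := mul_le_mul_of_nonneg_right h hpos.le
            rw [sub_mul, ← Real.exp_add, add_neg_cancel, Real.exp_zero] at h'
            have : Real.exp (-(t ^ 2 / 2)) ≤ 1 := by
              rw [Real.exp_le_one_iff]; have := sq_nonneg t; linarith
            have h3 : A * t ^ (2 * k) * Real.exp (-(t ^ 2 / 2)) ≤ A * t ^ (2 * k) :=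
              mul_le_of_le_one_right (mul_nonneg hA0.le (hev t)) this
            exact le_trans (by linarith) h'
          have hAt : A * t ^ (2 * k) ≤ 1 / (2 * n) := by
            calc A * t ^ (2 * k) ≤ A * (1 / (n * (2 * A))) := by gcongr
              _ = _ := by field_simp
          have h2n : 1 / (2 * (n : ℝ)) ≤ 1 / 2 := by
            apply one_div_le_one_div_of_le <;> linarith
          have hB := one_add_mul_le_pow (a := -(A * t ^ (2 * k))) (by linarith) n
          have hmono : (1 + -(A * t ^ (2 * k))) ^ n ≤ G t ^ n :=
            pow_le_pow_left₀ (by linarith) (by linarith) n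
          have : (n : ℝ) * (A * t ^ (2 * k)) ≤ 1 / 2 := by
            calc (n : ℝ) * (A * t ^ (2 * k)) ≤ n * (1 / (2 * n)) := by gcongr
              _ = 1 / 2 := by field_simp
          linarith
      _ ≤ _ := setLIntegral_le_lintegral _ _
  -- upper bound for the numerator
  have hGup : ∀ t, n * t ^ (2 * k) * G t ^ n ≤ Real.exp b₁ * K * (1 + (a * t) ^ 2)⁻¹ := by
    intro t
    have hu : (n : ℝ) * t ^ (2 * k) = (a * t) ^ (2 * k) := by rw [mul_pow, hapow]
    set u := a * t with hudef
    have habs : |u| = a * |t| := by rw [hudef, abs_mul, abs_of_pos ha0]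
    have hGn : G t ^ n ≤ Real.exp b₁ * Real.exp (-c * |u|) := by
      rw [← Real.exp_add]
      have hca : c * |u| ≤ b₁ * |u| := mul_le_mul_of_nonneg_right (min_le_left _ _) (abs_nonneg _)
      have hca2 : c * |u| ≤ d * b₀ * |u| :=
        mul_le_mul_of_nonneg_right (min_le_right _ _) (abs_nonneg _)
      rcases le_or_gt |t| b₀ with h | h
      · have h1 : G t ≤ Real.exp (-(b₁ * t ^ (2 * k))) := by
          calc G t ≤ Real.exp (t ^ 2 / 2 - b₁ * t ^ (2 * k)) * Real.exp (-(t ^ 2 / 2)) := by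
                apply mul_le_mul_of_nonneg_right (hM1 t h) (Real.exp_pos _).le
            _ = _ := by rw [← Real.exp_add]; congr 1; ring
        refine (pow_le_pow_left₀ (hGnn t) h1 n).trans ?_
        rw [← Real.exp_nat_mul]
        apply Real.exp_le_exp.2
        have hup : |u| ≤ 1 + u ^ (2 * k) := by
          rcases le_total |u| 1 with h1 | h1
          · have := hev u; linarith
          · rw [← (even_two_mul k).pow_abs]
            have := le_self_pow₀ h1 (n := 2 * k) (by omega)
            linarith
        have := mul_le_mul_of_nonneg_left hup hb₁.le
        have e : (n : ℝ) * -(b₁ * t ^ (2 * k)) = - (b₁ * u ^ (2 * k)) := by rw [← hu]; ring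
        rw [e]; linarith
      · have h1 : G t ≤ Real.exp (-(d * t ^ 2)) := by
          calc G t ≤ Real.exp (t ^ 2 / (2 * b₂)) * Real.exp (-(t ^ 2 / 2)) := by
                apply mul_le_mul_of_nonneg_right (hM2 t h) (Real.exp_pos _).le
            _ = _ := by
                rw [← Real.exp_add]; congr 1; rw [hd]
                have : b₂ ≠ 0 := by linarith
                field_simp; ring
        refine (pow_le_pow_left₀ (hGnn t) h1 n).trans ?_
        rw [← Real.exp_nat_mul]
        apply Real.exp_le_exp.2
        have h2 : b₀ * |t| ≤ t ^ 2 := by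
          rw [← sq_abs, sq]; exact mul_le_mul_of_nonneg_right h.le (abs_nonneg _)
        have h3 : a * (b₀ * |t|) ≤ n * t ^ 2 := mul_le_mul han h2 (by positivity) hn'.le
        have h4 := mul_le_mul_of_nonneg_left h3 hd0.le
        rw [habs] at *
        linarith
    rw [hu]
    calc _ ≤ u ^ (2 * k) * (Real.exp b₁ * Real.exp (-c * |u|)) :=
          mul_le_mul_of_nonneg_left hGn (hev u)
      _ = Real.exp b₁ * (u ^ (2 * k) * Real.exp (-c * |u|)) := by ring
      _ ≤ Real.exp b₁ * (K * (1 + u ^ 2)⁻¹) := mul_le_mul_of_nonneg_left (hK u) (Real.exp_pos _).le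
      _ = _ := by ring
  calc _ = ENNReal.ofReal n * ∫⁻ x, ENNReal.ofReal ((v * (∑ i, x i)) ^ (2 * k) *
          Real.exp (v * (∑ i, x i) ^ 2 / 2)) ∂(Measure.pi fun _ : Fin n => ρ) := by
        rw [← lintegral_const_mul _ (by fun_prop)]
        apply lintegral_congr
        intro x
        rw [← ENNReal.ofReal_mul hn'.le]
        congr 1
        rw [hna, hvr, ← mul_assoc]
        congr 1
        · rw [div_div_eq_mul_div, div_pow, mul_pow, hapow, mul_pow, div_pow, one_pow]
          field_simp
        · congr 1; field_simp
    _ ≤ ENNReal.ofReal n * ∫⁻ t, ENNReal.ofReal (t ^ (2 * k)) * ENNReal.ofReal (M t) ^ n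
        ∂(gaussianReal 0 v) := by
        gcongr
        simp only [← hml]
        exact expect_hs_moment ρ hv0 k
    _ = ∫⁻ t, ENNReal.ofReal (q * (n * t ^ (2 * k) * G t ^ n)) := by
        rw [gauss_lint hv0 _ _ (by fun_prop), ← lintegral_const_mul _ (by fun_prop)]
        apply lintegral_congr
        intro t
        rw [← hq, mul_left_comm (ENNReal.ofReal (q * _)), hdens t]
        have := hev t
        have := pow_nonneg (hGnn t) n
        rw [← ENNReal.ofReal_mul (hev t), ← ENNReal.ofReal_mul hn'.le]
        congr 1; ring
    _ ≤ ∫⁻ t, ENNReal.ofReal (q * (Real.exp b₁ * K * (1 + (a * t) ^ 2)⁻¹)) := by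
        exact lintegral_mono fun t => ENNReal.ofReal_le_ofReal
          (mul_le_mul_of_nonneg_left (hGup t) hq0.le)
    _ = ENNReal.ofReal (q * (Real.exp b₁ * K * (a⁻¹ * Real.pi))) := by
        have hI : Integrable fun t : ℝ => (1 + (a * t) ^ 2)⁻¹ :=
          integrable_inv_one_add_sq.comp_mul_left' ha0.ne'
        rw [← ofReal_integral_eq_lintegral_ofReal ((hI.const_mul _).const_mul _)
          (Eventually.of_forall fun t => by positivity), integral_const_mul, integral_const_mul,
          Measure.integral_comp_mul_left (fun y : ℝ => (1 + y ^ 2)⁻¹),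
          integral_univ_inv_one_add_sq, abs_of_pos (by positivity), smul_eq_mul]
    _ = ENNReal.ofReal (4 * A * (Real.exp b₁ * K * Real.pi)) * ENNReal.ofReal (q / (4 * A * a)) := by
        rw [← ENNReal.ofReal_mul (by positivity)]
        congr 1; field_simp
    _ ≤ _ := by gcongr

end CWAux

/-- Lemma 5.3, moment bounds for the Curie–Weiss magnetisation.
(i) At `β = 1`, for a type-`k` base measure with the critical mgf bounds,
`E (Sₙ / n^{1-1/(2k)})^{2k} ≤ C`.
(ii) For `0 < β < 1` with `∫ e^{tx} dρ ≤ e^{t²/(2b)}`, `b > β`, `E (Sₙ/√n)² ≤ C`. -/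
theorem curie_weiss_magnetisation_moment_bounds
    (ρ : Measure ℝ) [IsProbabilityMeasure ρ]
    (hmean : ∫ x, x ∂ρ = 0) (hvar : ∫ x, x ^ 2 ∂ρ = 1) :
    (∀ (k : ℕ), 1 ≤ k → ∀ lamρ : ℝ, 0 < lamρ →
      (∀ j : ℕ, j < 2 * k →
        (∫ x, x ^ j ∂(ProbabilityTheory.gaussianReal 0 1)) - ∫ x, x ^ j ∂ρ = 0) →
      ((∫ x, x ^ (2 * k) ∂(ProbabilityTheory.gaussianReal 0 1)) -
        ∫ x, x ^ (2 * k) ∂ρ = lamρ) →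
      ∀ b₀ b₁ b₂ : ℝ, 0 < b₀ → 0 < b₁ → 1 < b₂ →
      (∀ t : ℝ, |t| ≤ b₀ →
        ∫ x, Real.exp (t * x) ∂ρ ≤ Real.exp (t ^ 2 / 2 - b₁ * t ^ (2 * k))) →
      (∀ t : ℝ, b₀ < |t| →
        ∫ x, Real.exp (t * x) ∂ρ ≤ Real.exp (t ^ 2 / (2 * b₂))) →
      ∃ C : ℝ, 0 < C ∧
        ∀ n : ℕ, 0 < n →
          (∫ x, ((∑ i, x i) / (n : ℝ) ^ (1 - 1 / (2 * (k : ℝ)))) ^ (2 * k)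
            ∂(cwMeasure ρ 1 n)) ≤ C) ∧
    (∀ β b : ℝ, 0 < β → β < 1 → β < b →
      (∀ t : ℝ, ∫ x, Real.exp (t * x) ∂ρ ≤ Real.exp (t ^ 2 / (2 * b))) →
      ∃ C : ℝ, 0 < C ∧
        ∀ n : ℕ, 0 < n →
          (∫ x, ((∑ i, x i) / Real.sqrt n) ^ 2 ∂(cwMeasure ρ β n)) ≤ C) := by
  refine ⟨?_, ?_⟩
  · intro k hk _ _ hm _ b₀ b₁ b₂ h0 h1 h2 hM1 hM2
    exact CWAux.part_one ρ k hk hm b₀ b₁ b₂ h0 h1 h2 hM1 hM2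
  · intro β b hβ _ hb hM
    exact CWAux.part_two ρ β b hβ hb hM
end

section
/- Let (X₁, ..., Xₙ) follow the Curie-Weiss joint law dP_{n,β} with base measure ρ of mean 0 and variance 1. For each pair 1 ≤ i < j ≤ n: (i) if 0 < β < 1 and there is b > β with ∫ e^{tx} dρ(x) ≤ e^{t²/(2b)} for all real t, then |E( (X_i² − 1)(X_j² − 1) )| ≤ C n^{-1}; (ii) if β = 1, ρ is of type k with strength λ_ρ > 0, and there are constants b₀ > 0, b₁ > 0, b₂ > 1 with ∫ e^{tx} dρ(x) ≤ exp(t²/2 − b₁ t^{2k}) for |t| ≤ b₀ and ∫ e^{tx} dρ(x) ≤ exp(t²/(2b₂)) for |t| > b₀, then |E( (X_i² − 1)(X_j² − 1) )| ≤ C n^{-1/k}. In both cases C is a constant not depending on n, i, j. -/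
open MeasureTheory ProbabilityTheory Filter Set

/-- Gaussian linearization of the square. -/
lemma cw_gauss_lin (q : ℝ) (hq : 0 < q) (s : ℝ) :
    ∫ t : ℝ, Real.exp (-q * t ^ 2) * Real.exp (t * s)
      = Real.sqrt (Real.pi / q) * Real.exp (s ^ 2 / (4 * q)) := by
  have h : ∀ t : ℝ, Real.exp (-q * t ^ 2) * Real.exp (t * s)
      = Real.exp (s ^ 2 / (4 * q)) * Real.exp (-q * (t - s / (2 * q)) ^ 2) := by
    intro t
    rw [← Real.exp_add, ← Real.exp_add]
    congr 1
    field_simp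
    ring
  simp_rw [h]
  rw [integral_const_mul, integral_sub_right_eq_self (fun t => Real.exp (-q * t ^ 2)),
    integral_gaussian, mul_comm]

/-- Exponential of a sum times a product as a single product. -/
lemma cw_prod_exp {n : ℕ} (f : Fin n → ℝ → ℝ) (t : ℝ) (x : Fin n → ℝ) :
    Real.exp (t * ∑ l, x l) * ∏ l, f l (x l) = ∏ l, (Real.exp (t * x l) * f l (x l)) := by
  rw [Finset.prod_mul_distrib, ← Real.exp_sum, Finset.mul_sum]

/-- Hubbard–Stratonovich transform for product observables. -/
lemma cw_hs (ρ : Measure ℝ) [IsProbabilityMeasure ρ] {n : ℕ} (q : ℝ) (hq : 0 < q)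
    (f : Fin n → ℝ → ℝ) (hfm : ∀ l, Measurable (f l))
    (hf : ∀ l t, Integrable (fun x => Real.exp (t * x) * f l x) ρ)
    (hint : Integrable (fun t => Real.exp (-q * t ^ 2) *
      ∏ l, ∫ x, Real.exp (t * x) * |f l x| ∂ρ) volume) :
    Integrable (fun x : Fin n → ℝ => Real.exp ((∑ l, x l) ^ 2 / (4 * q)) * ∏ l, f l (x l))
      (Measure.pi fun _ => ρ) ∧
    Real.sqrt (Real.pi / q) * ∫ x : Fin n → ℝ, Real.exp ((∑ l, x l) ^ 2 / (4 * q)) *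
        ∏ l, f l (x l) ∂(Measure.pi fun _ => ρ)
      = ∫ t, Real.exp (-q * t ^ 2) * ∏ l, ∫ x, Real.exp (t * x) * f l x ∂ρ := by
  set P : Measure (Fin n → ℝ) := Measure.pi fun _ => ρ with hP
  let F : (Fin n → ℝ) → ℝ → ℝ := fun x t =>
    Real.exp (-q * t ^ 2) * (Real.exp (t * ∑ l, x l) * ∏ l, f l (x l))
  have hFm : Measurable (Function.uncurry F) := by
    have h1 : ∀ l, Measurable (fun p : (Fin n → ℝ) × ℝ => f l (p.1 l)) := fun l =>
      (hfm l).comp (by fun_prop)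
    have h2 : Measurable (fun p : (Fin n → ℝ) × ℝ => ∏ l, f l (p.1 l)) :=
      Finset.measurable_prod _ (fun l _ => h1 l)
    have h3 : Measurable (fun p : (Fin n → ℝ) × ℝ =>
      Real.exp (-q * p.2 ^ 2)) := by fun_prop
    have h4 : Measurable (fun p : (Fin n → ℝ) × ℝ =>
      Real.exp (p.2 * ∑ l, p.1 l)) := by fun_prop
    exact h3.mul (h4.mul h2)
  have hFi : Integrable (Function.uncurry F) (P.prod volume) := by
    rw [integrable_prod_iff' hFm.aestronglyMeasurable]
    constructor
    · refine Eventually.of_forall fun t => ?_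
      simp only [Function.uncurry, F]
      refine Integrable.const_mul ?_ _
      exact (Integrable.fintype_prod (f := fun l y => Real.exp (t * y) * f l y)
        (fun l => hf l t)).congr (Eventually.of_forall fun x => (cw_prod_exp f t x).symm)
    · refine hint.congr (Eventually.of_forall fun t => ?_)
      symm
      simp only [Function.uncurry, F, norm_mul, Real.norm_eq_abs, Real.abs_exp,
        Finset.abs_prod]
      rw [integral_const_mul]
      congr 1
      rw [← integral_fintype_prod_eq_prod (fun l y => Real.exp (t * y) * |f l y|)]
      refine integral_congr_ae (Eventually.of_forall fun x => ?_)
      exact cw_prod_exp (fun l y => |f l y|) t x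
  have hin : ∀ x : Fin n → ℝ, ∫ t, F x t = Real.sqrt (Real.pi / q) *
      (Real.exp ((∑ l, x l) ^ 2 / (4 * q)) * ∏ l, f l (x l)) := by
    intro x
    simp only [F]
    simp_rw [← mul_assoc]
    rw [integral_mul_const, cw_gauss_lin q hq]
  have hs : 0 < Real.sqrt (Real.pi / q) := Real.sqrt_pos.2 (by positivity)
  constructor
  · have := hFi.integral_prod_left
    have h2 := this.const_mul (Real.sqrt (Real.pi / q))⁻¹
    refine h2.congr (Eventually.of_forall fun x => ?_)
    simp only [Function.uncurry]
    rw [hin x, ← mul_assoc, inv_mul_cancel₀ hs.ne', one_mul]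
  · rw [← integral_const_mul]
    simp_rw [← hin]
    rw [integral_integral_swap hFi]
    refine integral_congr_ae (Eventually.of_forall fun t => ?_)
    simp only [F]
    rw [integral_const_mul]
    congr 1
    simp_rw [cw_prod_exp]
    exact integral_fintype_prod_eq_prod (fun l y => Real.exp (t * y) * f l y)

lemma cw_measurable (ρ : Measure ℝ) (β : ℝ) (n : ℕ) :
    Measurable fun x : Fin n → ℝ => Real.exp (β * (∑ i, x i) ^ 2 / (2 * n)) /
      ∫ y, Real.exp (β * (∑ i, y i) ^ 2 / (2 * n)) ∂(Measure.pi fun _ : Fin n => ρ) := by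
  fun_prop

/-- If some exponential moment is infinite, the formal measure is zero. -/
lemma cw_zero (ρ : Measure ℝ) [IsProbabilityMeasure ρ] (β : ℝ) (hβ : 0 < β) (t : ℝ)
    (ht : ¬ Integrable (fun x => Real.exp (t * x)) ρ) (n : ℕ) (hn : 0 < n) :
    cwMeasure ρ β n = 0 := by
  have hn' : (0:ℝ) < n := by exact_mod_cast hn
  have hni : ¬ Integrable (fun y : Fin n → ℝ => Real.exp (β * (∑ i, y i) ^ 2 / (2 * n)))
      (Measure.pi fun _ : Fin n => ρ) := by
    intro h
    have h1 : Integrable (fun y : Fin n → ℝ => Real.exp (t * ∑ i, y i))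
        (Measure.pi fun _ : Fin n => ρ) := by
      refine (h.const_mul (Real.exp (n * t ^ 2 / (2 * β)))).mono'
        (by fun_prop) (Eventually.of_forall fun y => ?_)
      rw [Real.norm_eq_abs, Real.abs_exp, ← Real.exp_add, Real.exp_le_exp]
      have : n * t ^ 2 / (2 * β) + β * (∑ i, y i) ^ 2 / (2 * n) - t * ∑ i, y i
        = (n * t - β * ∑ i, y i) ^ 2 / (2 * β * n) := by
        field_simp
        ring
      have h3 : 0 ≤ (n * t - β * ∑ i, y i) ^ 2 / (2 * β * n) := by positivity
      linarith
    have h2 : 0 < ∫ y : Fin n → ℝ, Real.exp (t * ∑ i, y i) ∂(Measure.pi fun _ : Fin n => ρ) :=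
      integral_exp_pos h1
    have h3 : ∫ y : Fin n → ℝ, Real.exp (t * ∑ i, y i) ∂(Measure.pi fun _ : Fin n => ρ)
        = ∏ l : Fin n, ∫ x, Real.exp (t * x) ∂ρ := by
      rw [← integral_fintype_prod_eq_prod (fun (_ : Fin n) y => Real.exp (t * y))]
      simp_rw [← Real.exp_sum, Finset.mul_sum]
    rw [h3, integral_undef ht] at h2
    simp [hn.ne'] at h2
  unfold cwMeasure
  rw [integral_undef hni]
  simp

lemma cw_integral (ρ : Measure ℝ) [IsProbabilityMeasure ρ] (β : ℝ) (n : ℕ)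
    (g : (Fin n → ℝ) → ℝ) :
    ∫ x, g x ∂(cwMeasure ρ β n) =
      (∫ x, Real.exp (β * (∑ i, x i) ^ 2 / (2 * n)) * g x ∂(Measure.pi fun _ : Fin n => ρ)) /
      ∫ y, Real.exp (β * (∑ i, y i) ^ 2 / (2 * n)) ∂(Measure.pi fun _ : Fin n => ρ) := by
  unfold cwMeasure
  rw [integral_withDensity_eq_integral_toReal_smul (cw_measurable ρ β n).ennreal_ofReal
    (Eventually.of_forall fun x => ENNReal.ofReal_lt_top), ← integral_div]
  refine integral_congr_ae (Eventually.of_forall fun x => ?_)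
  simp only [smul_eq_mul]
  rw [ENNReal.toReal_ofReal (div_nonneg (Real.exp_pos _).le
    (integral_nonneg fun _ => (Real.exp_pos _).le))]
  ring

lemma cw_exp_taylor (y : ℝ) (m : ℕ) :
    |Real.exp y - ∑ j ∈ Finset.range m, y ^ j / (j.factorial : ℝ)|
      ≤ |y| ^ m * Real.exp |y| := by
  have h := Complex.norm_exp_sub_sum_le_norm_mul_exp (y : ℂ) m
  have e : Complex.exp (y : ℂ) - ∑ j ∈ Finset.range m, (y : ℂ) ^ j / (j.factorial : ℂ)
      = ((Real.exp y - ∑ j ∈ Finset.range m, y ^ j / (j.factorial : ℝ) : ℝ) : ℂ) := by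
    push_cast
    rfl
  rw [e, Complex.norm_real, Complex.norm_real] at h
  exact h

lemma cw_exp_abs_le (s x : ℝ) : Real.exp (s * |x|) ≤ Real.exp (s * x) + Real.exp (-s * x) := by
  rcases abs_choice x with h | h <;> rw [h]
  · linarith [Real.exp_pos (-s * x)]
  · have : s * -x = -s * x := by ring
    rw [this]
    linarith [Real.exp_pos (s * x)]

lemma cw_int_exp_abs (ρ : Measure ℝ) (hI : ∀ t, Integrable (fun x => Real.exp (t * x)) ρ)
    (s : ℝ) : Integrable (fun x => Real.exp (s * |x|)) ρ := by
  refine ((hI s).add (hI (-s))).mono' (by fun_prop) (Eventually.of_forall fun x => ?_)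
  rw [Real.norm_eq_abs, Real.abs_exp]
  exact cw_exp_abs_le s x

lemma cw_exp_abs_bound (ρ : Measure ℝ) (hI : ∀ t, Integrable (fun x => Real.exp (t * x)) ρ)
    (D a : ℝ) (hM : ∀ t, ∫ x, Real.exp (t * x) ∂ρ ≤ D * Real.exp (a * t ^ 2)) (s : ℝ) :
    ∫ x, Real.exp (s * |x|) ∂ρ ≤ 2 * D * Real.exp (a * s ^ 2) := by
  have h1 : ∫ x, Real.exp (s * |x|) ∂ρ ≤ ∫ x, (Real.exp (s * x) + Real.exp (-s * x)) ∂ρ :=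
    integral_mono (cw_int_exp_abs ρ hI s) ((hI s).add (hI (-s))) (fun x => cw_exp_abs_le s x)
  rw [integral_add (hI s) (hI (-s))] at h1
  have h2 := hM s
  have h3 := hM (-s)
  have h4 : (-s) ^ 2 = s ^ 2 := by ring
  rw [h4] at h3
  linarith

lemma cw_pow_le_exp (y : ℝ) (hy : 0 ≤ y) (m : ℕ) :
    y ^ m ≤ (m.factorial : ℝ) * Real.exp y := by
  have := Real.pow_div_factorial_le_exp y hy m
  rw [div_le_iff₀ (by positivity)] at this
  linarith

lemma cw_int_pow_exp (ρ : Measure ℝ) (hI : ∀ t, Integrable (fun x => Real.exp (t * x)) ρ)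
    (m : ℕ) (s : ℝ) : Integrable (fun x => |x| ^ m * Real.exp (s * |x|)) ρ := by
  refine ((cw_int_exp_abs ρ hI (1 + s)).const_mul (m.factorial : ℝ)).mono' (by fun_prop)
    (Eventually.of_forall fun x => ?_)
  rw [Real.norm_eq_abs, abs_of_nonneg (by positivity), add_mul, one_mul, Real.exp_add, ← mul_assoc]
  gcongr
  exact cw_pow_le_exp _ (abs_nonneg x) m

/-- Uniform Taylor expansion of the moment generating function near zero. -/
lemma cw_mgf_taylor (ρ : Measure ℝ) [IsProbabilityMeasure ρ]
    (hI : ∀ t, Integrable (fun x => Real.exp (t * x)) ρ) (m : ℕ) (t : ℝ) (ht : |t| ≤ 1) :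
    |∫ x, Real.exp (t * x) ∂ρ -
      ∑ j ∈ Finset.range m, t ^ j / (j.factorial : ℝ) * ∫ x, x ^ j ∂ρ|
      ≤ |t| ^ m * ∫ x, |x| ^ m * Real.exp (1 * |x|) ∂ρ := by
  have hpow : ∀ j : ℕ, Integrable (fun x : ℝ => x ^ j) ρ := by
    intro j
    refine (cw_int_pow_exp ρ hI j 0).mono' (by fun_prop) (Eventually.of_forall fun x => ?_)
    simp
  have h1 : ∑ j ∈ Finset.range m, t ^ j / (j.factorial : ℝ) * ∫ x, x ^ j ∂ρ
      = ∫ x, ∑ j ∈ Finset.range m, t ^ j / (j.factorial : ℝ) * x ^ j ∂ρ := by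
    rw [integral_finsetSum _ (fun j _ => (hpow j).const_mul _)]
    simp_rw [integral_const_mul]
  rw [h1, ← integral_sub (hI t) (integrable_finsetSum _ (fun j _ => (hpow j).const_mul _)),
    ← integral_const_mul, ← Real.norm_eq_abs]
  refine norm_integral_le_of_norm_le ((cw_int_pow_exp ρ hI m 1).const_mul _)
    (Eventually.of_forall fun x => ?_)
  have h2 := cw_exp_taylor (t * x) m
  have h3 : ∀ j : ℕ, (t * x) ^ j / (j.factorial : ℝ) = t ^ j / (j.factorial : ℝ) * x ^ j := by
    intro j
    rw [mul_pow]
    ring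
  simp_rw [h3] at h2
  rw [Real.norm_eq_abs]
  refine h2.trans ?_
  rw [abs_mul, mul_pow, mul_assoc]
  gcongr

lemma cw_sq_le (t : ℝ) : (|t| + 1) ^ 2 ≤ 2 * t ^ 2 + 2 := by
  nlinarith [sq_nonneg (|t| - 1), sq_abs t]

lemma cw_exp_shift (ρ : Measure ℝ) (hI : ∀ t, Integrable (fun x => Real.exp (t * x)) ρ)
    (D a : ℝ) (hD : 0 ≤ D) (ha : 0 ≤ a)
    (hM : ∀ t, ∫ x, Real.exp (t * x) ∂ρ ≤ D * Real.exp (a * t ^ 2)) (t : ℝ) :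
    ∫ x, Real.exp ((|t| + 1) * |x|) ∂ρ ≤ 2 * D * Real.exp (2 * a) * Real.exp (2 * a * t ^ 2) := by
  refine (cw_exp_abs_bound ρ hI D a hM (|t| + 1)).trans ?_
  rw [mul_assoc (2 * D), ← Real.exp_add]
  have := mul_le_mul_of_nonneg_left (cw_sq_le t) ha
  gcongr
  linarith

lemma cw_H_pt (t x : ℝ) : Real.exp (t * x) * |x ^ 2 - 1| ≤ 3 * Real.exp ((|t| + 1) * |x|) := by
  have h1 : t * x ≤ |t| * |x| := by rw [← abs_mul]; exact le_abs_self _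
  have h2 : |x ^ 2 - 1| ≤ 3 * Real.exp |x| := by
    have h3 := cw_pow_le_exp |x| (abs_nonneg x) 2
    have h4 : (1:ℝ) ≤ Real.exp |x| := Real.one_le_exp (abs_nonneg x)
    rw [sq_abs] at h3
    norm_num [Nat.factorial] at h3
    rw [abs_le]
    constructor <;> nlinarith [sq_nonneg x]
  calc Real.exp (t * x) * |x ^ 2 - 1| ≤ Real.exp (|t| * |x|) * (3 * Real.exp |x|) := by gcongr
    _ = 3 * Real.exp ((|t| + 1) * |x|) := by
      rw [add_mul, one_mul, Real.exp_add]; ring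

lemma cw_G_pt (t x : ℝ) :
    |(Real.exp (t * x) - 1) * (x ^ 2 - 1)| ≤ |t| * (7 * Real.exp ((|t| + 1) * |x|)) := by
  have h1 := cw_exp_taylor (t * x) 1
  simp only [Finset.range_one, Finset.sum_singleton, pow_zero, Nat.factorial_zero, Nat.cast_one,
    div_one, pow_one, abs_mul] at h1
  have h2 : |x| * |x ^ 2 - 1| ≤ 7 * Real.exp |x| := by
    have h3 := cw_pow_le_exp |x| (abs_nonneg x) 3
    have h4 := cw_pow_le_exp |x| (abs_nonneg x) 1
    norm_num [Nat.factorial] at h3 h4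
    have h5 : |x ^ 2 - 1| ≤ |x| ^ 2 + 1 := by
      rw [sq_abs, abs_le]
      constructor <;> nlinarith [sq_nonneg x]
    nlinarith [mul_le_mul_of_nonneg_left h5 (abs_nonneg x)]
  rw [abs_mul]
  calc |Real.exp (t * x) - 1| * |x ^ 2 - 1|
      ≤ (|t| * |x| * Real.exp (|t| * |x|)) * |x ^ 2 - 1| := by gcongr
    _ = |t| * Real.exp (|t| * |x|) * (|x| * |x ^ 2 - 1|) := by ring
    _ ≤ |t| * Real.exp (|t| * |x|) * (7 * Real.exp |x|) := by gcongr
    _ = |t| * (7 * Real.exp ((|t| + 1) * |x|)) := by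
      rw [add_mul, one_mul, Real.exp_add]; ring

lemma cw_H_int (ρ : Measure ℝ) (hI : ∀ t, Integrable (fun x => Real.exp (t * x)) ρ) (t : ℝ) :
    Integrable (fun x => Real.exp (t * x) * |x ^ 2 - 1|) ρ := by
  refine ((cw_int_exp_abs ρ hI (|t| + 1)).const_mul 3).mono' (by fun_prop)
    (Eventually.of_forall fun x => ?_)
  rw [Real.norm_eq_abs, abs_of_nonneg (by positivity)]
  exact cw_H_pt t x

lemma cw_G_int (ρ : Measure ℝ) (hI : ∀ t, Integrable (fun x => Real.exp (t * x)) ρ) (t : ℝ) :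
    Integrable (fun x => Real.exp (t * x) * (x ^ 2 - 1)) ρ := by
  refine (cw_H_int ρ hI t).mono' (by fun_prop) (Eventually.of_forall fun x => ?_)
  rw [Real.norm_eq_abs, abs_mul, Real.abs_exp]

lemma cw_H_bound (ρ : Measure ℝ) (hI : ∀ t, Integrable (fun x => Real.exp (t * x)) ρ)
    (D a : ℝ) (hD : 0 ≤ D) (ha : 0 ≤ a)
    (hM : ∀ t, ∫ x, Real.exp (t * x) ∂ρ ≤ D * Real.exp (a * t ^ 2)) (t : ℝ) :
    ∫ x, Real.exp (t * x) * |x ^ 2 - 1| ∂ρ ≤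
      14 * D * Real.exp (2 * a) * Real.exp (2 * a * t ^ 2) := by
  have h := integral_mono (cw_H_int ρ hI t) ((cw_int_exp_abs ρ hI (|t| + 1)).const_mul 3)
    (fun x => cw_H_pt t x)
  rw [integral_const_mul] at h
  have h2 := cw_exp_shift ρ hI D a hD ha hM t
  have h3 : 0 ≤ D * Real.exp (2 * a) * Real.exp (2 * a * t ^ 2) := by positivity
  nlinarith

lemma cw_G_bound (ρ : Measure ℝ) [IsProbabilityMeasure ρ]
    (hI : ∀ t, Integrable (fun x => Real.exp (t * x)) ρ) (hvar : ∫ x, x ^ 2 ∂ρ = 1)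
    (D a : ℝ) (hD : 0 ≤ D) (ha : 0 ≤ a)
    (hM : ∀ t, ∫ x, Real.exp (t * x) ∂ρ ≤ D * Real.exp (a * t ^ 2)) (t : ℝ) :
    |∫ x, Real.exp (t * x) * (x ^ 2 - 1) ∂ρ| ≤
      |t| * (14 * D * Real.exp (2 * a) * Real.exp (2 * a * t ^ 2)) := by
  have h0 := cw_G_int ρ hI 0
  simp only [zero_mul, Real.exp_zero, one_mul] at h0
  have hz : ∫ x, (x ^ 2 - 1) ∂ρ = 0 := by
    have hi : Integrable (fun x : ℝ => x ^ 2) ρ := by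
      refine (h0.add (integrable_const (1:ℝ))).congr (Eventually.of_forall fun x => ?_)
      simp
    rw [integral_sub hi (integrable_const _), hvar]
    simp
  have e : ∫ x, Real.exp (t * x) * (x ^ 2 - 1) ∂ρ
      = ∫ x, (Real.exp (t * x) - 1) * (x ^ 2 - 1) ∂ρ := by
    rw [← sub_zero (∫ x, Real.exp (t * x) * (x ^ 2 - 1) ∂ρ), ← hz,
      ← integral_sub (cw_G_int ρ hI t) h0]
    refine integral_congr_ae (Eventually.of_forall fun x => ?_)
    ring
  rw [e, ← Real.norm_eq_abs]
  have h := norm_integral_le_of_norm_le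
    (((cw_int_exp_abs ρ hI (|t| + 1)).const_mul 7).const_mul |t|)
    (Eventually.of_forall fun x => (by rw [Real.norm_eq_abs]; exact cw_G_pt t x) :
      ∀ᵐ x ∂ρ, ‖(Real.exp (t * x) - 1) * (x ^ 2 - 1)‖ ≤ _)
  refine h.trans ?_
  rw [integral_const_mul, integral_const_mul]
  have h2 := cw_exp_shift ρ hI D a hD ha hM t
  refine mul_le_mul_of_nonneg_left ?_ (abs_nonneg t)
  linarith

/-- Jensen lower bound: the moment generating function is at least one. -/
lemma cw_mgf_ge_one (ρ : Measure ℝ) [IsProbabilityMeasure ρ]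
    (hI : ∀ t, Integrable (fun x => Real.exp (t * x)) ρ) (hmean : ∫ x, x ∂ρ = 0) (t : ℝ) :
    1 ≤ ∫ x, Real.exp (t * x) ∂ρ := by
  have hx : Integrable (fun x : ℝ => x) ρ := by
    refine (cw_int_pow_exp ρ hI 1 0).mono' (by fun_prop) (Eventually.of_forall fun x => ?_)
    simp
  have h : ∫ x, (t * x + 1) ∂ρ ≤ ∫ x, Real.exp (t * x) ∂ρ :=
    integral_mono ((hx.const_mul t).add (integrable_const _)) (hI t)
      (fun x => Real.add_one_le_exp _)
  rw [integral_add (hx.const_mul t) (integrable_const _), integral_const_mul, hmean] at h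
  simpa using h

lemma cw_mgf_meas (ρ : Measure ℝ) [IsProbabilityMeasure ρ] (f : ℝ → ℝ) (hf : Measurable f) :
    Measurable (fun t => ∫ x, Real.exp (t * x) * f x ∂ρ) := by
  have : StronglyMeasurable (fun p : ℝ × ℝ => Real.exp (p.1 * p.2) * f p.2) := by
    apply Measurable.stronglyMeasurable
    have : Measurable (fun p : ℝ × ℝ => f p.2) := hf.comp measurable_snd
    exact (by fun_prop : Measurable fun p : ℝ × ℝ => Real.exp (p.1 * p.2)).mul this
  exact (this.integral_prod_right' (ν := ρ)).measurable

lemma cw_filter_pair {n : ℕ} (i j : Fin n) :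
    (Finset.univ.filter fun l : Fin n => l = i ∨ l = j) = {i, j} := by
  ext l
  simp

lemma cw_prod_two {n : ℕ} (i j : Fin n) (hij : i < j) (A B : ℝ) :
    ∏ l : Fin n, (if l = i ∨ l = j then A else B) = B ^ (n - 2) * A ^ 2 := by
  rw [Finset.prod_ite, Finset.prod_const, Finset.prod_const, Finset.filter_not,
    Finset.card_sdiff_of_subset (Finset.filter_subset _ _), cw_filter_pair,
    Finset.card_pair hij.ne, Finset.card_univ, Fintype.card_fin, mul_comm]

lemma cw_prod_obs {n : ℕ} (i j : Fin n) (hij : i < j) (g : ℝ → ℝ) (x : Fin n → ℝ) :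
    ∏ l : Fin n, (if l = i ∨ l = j then g else fun _ => 1) (x l) = g (x i) * g (x j) := by
  have : ∀ l : Fin n, (if l = i ∨ l = j then g else fun _ => 1) (x l)
      = if l = i ∨ l = j then g (x l) else 1 := by
    intro l
    split_ifs <;> rfl
  simp_rw [this]
  rw [← Finset.prod_filter, cw_filter_pair, Finset.prod_pair hij.ne]

lemma cw_cov (ρ : Measure ℝ) [IsProbabilityMeasure ρ]
    (hI : ∀ t, Integrable (fun x => Real.exp (t * x)) ρ)
    (D a : ℝ) (hD : 0 ≤ D) (ha : 0 ≤ a)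
    (hM : ∀ t, ∫ x, Real.exp (t * x) ∂ρ ≤ D * Real.exp (a * t ^ 2))
    (β : ℝ) (hβ : 0 < β) (n : ℕ) (hn : 0 < n) (i j : Fin n) (hij : i < j)
    (hq : a * n + 2 * a < n / (2 * β)) :
    Integrable (fun t => Real.exp (-(n / (2 * β)) * t ^ 2) * (∫ x, Real.exp (t * x) ∂ρ) ^ n) ∧
    (∫ x, (x i ^ 2 - 1) * (x j ^ 2 - 1) ∂(cwMeasure ρ β n)) *
      (∫ t, Real.exp (-(n / (2 * β)) * t ^ 2) * (∫ x, Real.exp (t * x) ∂ρ) ^ n)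
      = ∫ t, Real.exp (-(n / (2 * β)) * t ^ 2) * ((∫ x, Real.exp (t * x) ∂ρ) ^ (n - 2) *
          (∫ x, Real.exp (t * x) * (x ^ 2 - 1) ∂ρ) ^ 2) := by
  have hn' : (0:ℝ) < n := by exact_mod_cast hn
  have hn2 : 2 ≤ n := by
    have := j.isLt
    have h2 : i.val < j.val := hij
    omega
  set q : ℝ := n / (2 * β) with hqdef
  have hq0 : 0 < q := by positivity
  have hM0 : ∀ t, 0 ≤ ∫ x, Real.exp (t * x) ∂ρ := fun t =>
    integral_nonneg fun _ => (Real.exp_pos _).le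
  have hMm : Measurable (fun t => ∫ x, Real.exp (t * x) ∂ρ) := by
    simpa using cw_mgf_meas ρ (fun _ => 1) measurable_const
  have hMpow : ∀ (t : ℝ) (m : ℕ), (∫ x, Real.exp (t * x) ∂ρ) ^ m
      ≤ D ^ m * Real.exp (m * a * t ^ 2) := by
    intro t m
    calc (∫ x, Real.exp (t * x) ∂ρ) ^ m ≤ (D * Real.exp (a * t ^ 2)) ^ m :=
          pow_le_pow_left₀ (hM0 t) (hM t) m
      _ = D ^ m * Real.exp (m * a * t ^ 2) := by
          rw [mul_pow, ← Real.exp_nat_mul, mul_assoc]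
  have hden : Integrable (fun t => Real.exp (-q * t ^ 2) * (∫ x, Real.exp (t * x) ∂ρ) ^ n) := by
    refine ((integrable_exp_neg_mul_sq (b := q - n * a) (by nlinarith)).const_mul (D ^ n)).mono'
      ((by fun_prop : Measurable fun t : ℝ => Real.exp (-q * t ^ 2)).mul
        (hMm.pow_const n)).aestronglyMeasurable (Eventually.of_forall fun t => ?_)
    rw [Real.norm_eq_abs, abs_of_nonneg (mul_nonneg (Real.exp_pos _).le (pow_nonneg (hM0 t) n))]
    calc _ ≤ Real.exp (-q * t ^ 2) * (D ^ n * Real.exp (n * a * t ^ 2)) := by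
          gcongr
          exact hMpow t n
      _ = D ^ n * (Real.exp (-q * t ^ 2) * Real.exp (n * a * t ^ 2)) := by ring
      _ = _ := by rw [← Real.exp_add]; ring_nf
  -- denominator
  have h1 := cw_hs ρ q hq0 (fun (_ : Fin n) _ => 1) (fun _ => measurable_const)
    (fun l t => by simpa using hI t) (by simpa using hden)
  -- numerator
  let g : ℝ → ℝ := fun x => x ^ 2 - 1
  have hgm : Measurable g := by fun_prop
  let f : Fin n → ℝ → ℝ := fun l => if l = i ∨ l = j then g else fun _ => 1
  have hfl : ∀ t (l : Fin n), ∫ x, Real.exp (t * x) * f l x ∂ρ = if l = i ∨ l = j then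
      ∫ x, Real.exp (t * x) * (x ^ 2 - 1) ∂ρ else ∫ x, Real.exp (t * x) ∂ρ := by
    intro t l
    simp only [f]
    split_ifs
    · rfl
    · simp
  have hfla : ∀ t (l : Fin n), ∫ x, Real.exp (t * x) * |f l x| ∂ρ = if l = i ∨ l = j then
      ∫ x, Real.exp (t * x) * |x ^ 2 - 1| ∂ρ else ∫ x, Real.exp (t * x) ∂ρ := by
    intro t l
    simp only [f]
    split_ifs
    · rfl
    · simp
  have hint : Integrable (fun t => Real.exp (-q * t ^ 2) *
      ∏ l, ∫ x, Real.exp (t * x) * |f l x| ∂ρ) volume := by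
    simp_rw [hfla, cw_prod_two i j hij]
    have hHm : Measurable (fun t => ∫ x, Real.exp (t * x) * |x ^ 2 - 1| ∂ρ) :=
      cw_mgf_meas ρ (fun x => |x ^ 2 - 1|) (by fun_prop)
    have hH0 : ∀ t, 0 ≤ ∫ x, Real.exp (t * x) * |x ^ 2 - 1| ∂ρ := fun t =>
      integral_nonneg fun _ => mul_nonneg (Real.exp_pos _).le (abs_nonneg _)
    refine ((integrable_exp_neg_mul_sq (b := q - (a * n + 2 * a)) (by linarith)).const_mul
      (D ^ (n - 2) * (14 * D * Real.exp (2 * a)) ^ 2)).mono'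
      ((by fun_prop : Measurable fun t : ℝ => Real.exp (-q * t ^ 2)).mul
        ((hMm.pow_const (n - 2)).mul (hHm.pow_const 2))).aestronglyMeasurable
      (Eventually.of_forall fun t => ?_)
    rw [Real.norm_eq_abs, abs_of_nonneg (mul_nonneg (Real.exp_pos _).le
      (mul_nonneg (pow_nonneg (hM0 t) _) (pow_nonneg (hH0 t) _)))]
    calc _ ≤ Real.exp (-q * t ^ 2) * ((D ^ (n - 2) * Real.exp ((n - 2 : ℕ) * a * t ^ 2)) *
            (14 * D * Real.exp (2 * a) * Real.exp (2 * a * t ^ 2)) ^ 2) := by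
          gcongr
          · exact hMpow t _
          · exact cw_H_bound ρ hI D a hD ha hM t
      _ = (D ^ (n - 2) * (14 * D * Real.exp (2 * a)) ^ 2) * (Real.exp (-q * t ^ 2) *
            Real.exp ((n - 2 : ℕ) * a * t ^ 2) * Real.exp (2 * a * t ^ 2) ^ 2) := by ring
      _ = _ := by
          rw [← Real.exp_nat_mul, ← Real.exp_add, ← Real.exp_add]
          push_cast [Nat.cast_sub hn2]
          ring_nf
  have h2 := cw_hs ρ q hq0 f (fun l => by
      simp only [f]
      split_ifs
      · exact hgm
      · exact measurable_const)
    (fun l t => by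
      simp only [f]
      split_ifs
      · exact cw_G_int ρ hI t
      · simpa using hI t) hint
  refine ⟨hden, ?_⟩
  have e1 := h1.2
  have e2 := h2.2
  simp_rw [hfl, cw_prod_two i j hij] at e2
  simp only [Finset.prod_const_one, mul_one, Finset.prod_const, Finset.card_univ,
    Fintype.card_fin] at e1
  have hi1 := h1.1
  simp only [Finset.prod_const_one, mul_one] at hi1
  have hpo : ∀ x : Fin n → ℝ, ∏ l, f l (x l) = (x i ^ 2 - 1) * (x j ^ 2 - 1) :=
    fun x => cw_prod_obs i j hij g x
  simp_rw [hpo] at e2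
  have hexp : ∀ x : Fin n → ℝ, β * (∑ l, x l) ^ 2 / (2 * n) = (∑ l, x l) ^ 2 / (4 * q) := by
    intro x
    rw [hqdef]
    field_simp
    ring
  rw [cw_integral]
  simp_rw [hexp]
  rw [← e1, ← e2]
  have hZ : 0 < ∫ x : Fin n → ℝ, Real.exp ((∑ l, x l) ^ 2 / (4 * q)) ∂(Measure.pi fun _ => ρ) :=
    integral_exp_pos hi1
  field_simp

lemma cw_ratio (ρ : Measure ℝ) [IsProbabilityMeasure ρ]
    (hI : ∀ t, Integrable (fun x => Real.exp (t * x)) ρ) (hvar : ∫ x, x ^ 2 ∂ρ = 1)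
    (D a : ℝ) (hD : 0 ≤ D) (ha : 0 ≤ a)
    (hM : ∀ t, ∫ x, Real.exp (t * x) ∂ρ ≤ D * Real.exp (a * t ^ 2))
    (β : ℝ) (hβ : 0 < β) (n : ℕ) (hn : 0 < n) (i j : Fin n) (hij : i < j)
    (hq : a * n + 2 * a < n / (2 * β))
    (Ψ : ℝ → ℝ) (hΨ : Integrable Ψ)
    (hub : ∀ t, Real.exp (-(n / (2 * β)) * t ^ 2) * (∫ x, Real.exp (t * x) ∂ρ) ^ (n - 2) *
      (t ^ 2 * Real.exp (4 * a * t ^ 2)) ≤ Ψ t)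
    (ε c : ℝ) (hε : 0 < ε) (hc : 0 < c)
    (hlb : ∀ t, |t| ≤ ε →
      c ≤ Real.exp (-(n / (2 * β)) * t ^ 2) * (∫ x, Real.exp (t * x) ∂ρ) ^ n) :
    |∫ x, (x i ^ 2 - 1) * (x j ^ 2 - 1) ∂(cwMeasure ρ β n)| ≤
      ((14 * D * Real.exp (2 * a)) ^ 2 * ∫ t, Ψ t) / (2 * ε * c) := by
  obtain ⟨h1, h2⟩ := cw_cov ρ hI D a hD ha hM β hβ n hn i j hij hq
  have hM0 : ∀ t, 0 ≤ ∫ x, Real.exp (t * x) ∂ρ := fun t =>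
    integral_nonneg fun _ => (Real.exp_pos _).le
  set K := 14 * D * Real.exp (2 * a) with hK
  have hden : 2 * ε * c ≤ ∫ t, Real.exp (-(n / (2 * β)) * t ^ 2) *
      (∫ x, Real.exp (t * x) ∂ρ) ^ n := by
    have h3 : ∫ t in Icc (-ε) ε, c ≤ ∫ t in Icc (-ε) ε, Real.exp (-(n / (2 * β)) * t ^ 2) *
      (∫ x, Real.exp (t * x) ∂ρ) ^ n := by
      refine setIntegral_mono_on (integrable_const _) h1.integrableOn measurableSet_Icc ?_
      intro t ht
      exact hlb t (abs_le.2 ht)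
    have h4 := setIntegral_le_integral (s := Icc (-ε) ε) h1 (Eventually.of_forall fun t =>
      mul_nonneg (Real.exp_pos _).le (pow_nonneg (hM0 t) n))
    have h5 : ∫ t in Icc (-ε) ε, c = 2 * ε * c := by
      rw [setIntegral_const, Real.volume_real_Icc_of_le (by linarith), smul_eq_mul]
      ring
    linarith
  have hnum : |∫ t, Real.exp (-(n / (2 * β)) * t ^ 2) * ((∫ x, Real.exp (t * x) ∂ρ) ^ (n - 2) *
          (∫ x, Real.exp (t * x) * (x ^ 2 - 1) ∂ρ) ^ 2)| ≤ K ^ 2 * ∫ t, Ψ t := by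
    rw [← integral_const_mul, ← Real.norm_eq_abs]
    refine norm_integral_le_of_norm_le (hΨ.const_mul _) (Eventually.of_forall fun t => ?_)
    rw [Real.norm_eq_abs, abs_of_nonneg (mul_nonneg (Real.exp_pos _).le
      (mul_nonneg (pow_nonneg (hM0 t) _) (sq_nonneg _)))]
    have hG : (∫ x, Real.exp (t * x) * (x ^ 2 - 1) ∂ρ) ^ 2 ≤
        K ^ 2 * (t ^ 2 * Real.exp (4 * a * t ^ 2)) := by
      have := cw_G_bound ρ hI hvar D a hD ha hM t
      rw [← hK] at this
      rw [← sq_abs]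
      calc _ ≤ (|t| * (K * Real.exp (2 * a * t ^ 2))) ^ 2 :=
            pow_le_pow_left₀ (abs_nonneg _) this 2
        _ = K ^ 2 * (|t| ^ 2 * Real.exp (2 * a * t ^ 2) ^ 2) := by ring
        _ = _ := by
            rw [sq_abs, ← Real.exp_nat_mul]
            push_cast
            ring_nf
    calc _ ≤ Real.exp (-(n / (2 * β)) * t ^ 2) * ((∫ x, Real.exp (t * x) ∂ρ) ^ (n - 2) *
          (K ^ 2 * (t ^ 2 * Real.exp (4 * a * t ^ 2)))) := by
          refine mul_le_mul_of_nonneg_left ?_ (Real.exp_pos _).le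
          exact mul_le_mul_of_nonneg_left hG (pow_nonneg (hM0 t) _)
      _ = K ^ 2 * (Real.exp (-(n / (2 * β)) * t ^ 2) * (∫ x, Real.exp (t * x) ∂ρ) ^ (n - 2) *
          (t ^ 2 * Real.exp (4 * a * t ^ 2))) := by ring
      _ ≤ _ := mul_le_mul_of_nonneg_left (hub t) (sq_nonneg _)
  rw [← h2, abs_mul] at hnum
  rw [le_div_iff₀ (by positivity)]
  refine le_trans ?_ hnum
  exact mul_le_mul_of_nonneg_left (hden.trans (le_abs_self _)) (abs_nonneg _)

/-- Scaling of the weighted integrals. -/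
lemma cw_psi_integrable (k : ℕ) (hk : 1 ≤ k) (c : ℝ) (hc : 0 < c) :
    Integrable (fun t : ℝ => t ^ 2 * Real.exp (-c * t ^ (2 * k))) := by
  have h := (integrable_rpow_mul_exp_neg_mul_sq hc (s := 2) (by norm_num)).const_mul (Real.exp c)
  refine h.mono' (by fun_prop) (Eventually.of_forall fun t => ?_)
  have h0 : 0 ≤ t ^ (2 * k) := by rw [pow_mul]; positivity
  rw [Real.norm_eq_abs, abs_of_nonneg (by positivity)]
  have h1 : t ^ 2 - 1 ≤ t ^ (2 * k) := by
    rw [pow_mul]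
    rcases le_total (t ^ 2) 1 with h | h
    · have : 0 ≤ (t ^ 2) ^ k := by positivity
      linarith
    · have := le_self_pow₀ h (by omega : k ≠ 0)
      linarith
  have h2 : Real.exp (-c * t ^ (2 * k)) ≤ Real.exp c * Real.exp (-c * t ^ 2) := by
    rw [← Real.exp_add, Real.exp_le_exp]
    nlinarith
  have h3 : t ^ (2:ℝ) = t ^ 2 := by norm_cast
  rw [h3]
  calc _ ≤ t ^ 2 * (Real.exp c * Real.exp (-c * t ^ 2)) := by gcongr
    _ = _ := by ring

lemma cw_psi_scale (k : ℕ) (hk : 1 ≤ k) (c : ℝ) (hc : 0 < c) (r : ℝ) (hr : 0 < r) :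
    Integrable (fun t : ℝ => t ^ 2 * Real.exp (-c * (r * t) ^ (2 * k))) ∧
    ∫ t : ℝ, t ^ 2 * Real.exp (-c * (r * t) ^ (2 * k)) =
      (r ^ 3)⁻¹ * ∫ t : ℝ, t ^ 2 * Real.exp (-c * t ^ (2 * k)) := by
  have e : ∀ t : ℝ, t ^ 2 * Real.exp (-c * (r * t) ^ (2 * k)) = (r ^ 2)⁻¹ *
      ((r * t) ^ 2 * Real.exp (-c * (r * t) ^ (2 * k))) := by
    intro t
    field_simp
  simp_rw [e]
  constructor
  · exact ((cw_psi_integrable k hk c hc).comp_mul_left' hr.ne').const_mul _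
  · rw [integral_const_mul, Measure.integral_comp_mul_left
      (fun t : ℝ => t ^ 2 * Real.exp (-c * t ^ (2 * k))) r, abs_of_pos (by positivity), smul_eq_mul,
      ← mul_assoc]
    congr 1
    field_simp

/-- Finitely many exceptional sizes can be absorbed in the constant. -/
lemma cw_finite (F : ∀ n : ℕ, Fin n → Fin n → ℝ) (s : ℕ → ℝ) (hs : ∀ n, 0 < n → 0 < s n)
    (C : ℝ) (N : ℕ) (h : ∀ n, N ≤ n → 0 < n → ∀ i j : Fin n, i < j → |F n i j| ≤ C * s n) :
    ∃ C : ℝ, 0 < C ∧ ∀ n, 0 < n → ∀ i j : Fin n, i < j → |F n i j| ≤ C * s n := by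
  let T : ℝ := ∑ n ∈ Finset.range N, |∑ i : Fin n, ∑ j : Fin n, |F n i j| / s n|
  have hT : 0 ≤ T := Finset.sum_nonneg fun _ _ => abs_nonneg _
  refine ⟨|C| + T + 1, by positivity, ?_⟩
  intro n hn i j hij
  have hsn := hs n hn
  rcases le_or_gt N n with hN | hN
  · refine (h n hN hn i j hij).trans ?_
    gcongr
    linarith [le_abs_self C]
  · have h1 : |F n i j| / s n ≤ ∑ j : Fin n, |F n i j| / s n :=
      Finset.single_le_sum (f := fun j => |F n i j| / s n) (fun _ _ => by positivity)
        (Finset.mem_univ j)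
    have h2 : ∑ j : Fin n, |F n i j| / s n ≤ ∑ i : Fin n, ∑ j : Fin n, |F n i j| / s n :=
      Finset.single_le_sum (f := fun i => ∑ j : Fin n, |F n i j| / s n)
        (fun _ _ => Finset.sum_nonneg fun _ _ => by positivity) (Finset.mem_univ i)
    have h3 : |∑ i : Fin n, ∑ j : Fin n, |F n i j| / s n| ≤ T :=
      Finset.single_le_sum (f := fun n => |∑ i : Fin n, ∑ j : Fin n, |F n i j| / s n|)
        (fun _ _ => abs_nonneg _) (Finset.mem_range.2 hN)
    have h4 := le_abs_self (∑ i : Fin n, ∑ j : Fin n, |F n i j| / s n)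
    rw [← div_le_iff₀ hsn]
    linarith [abs_nonneg C]

lemma cw_final (ρ : Measure ℝ) [IsProbabilityMeasure ρ]
    (hI : ∀ t, Integrable (fun x => Real.exp (t * x)) ρ) (hvar : ∫ x, x ^ 2 ∂ρ = 1)
    (D a : ℝ) (hD : 0 ≤ D) (ha : 0 ≤ a)
    (hM : ∀ t, ∫ x, Real.exp (t * x) ∂ρ ≤ D * Real.exp (a * t ^ 2))
    (β : ℝ) (hβ : 0 < β) (k : ℕ) (hk : 1 ≤ k) (N : ℕ)
    (hq : ∀ n : ℕ, N ≤ n → a * n + 2 * a < n / (2 * β))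
    (L c : ℝ) (hL : 0 < L) (hc : 0 < c)
    (hub : ∀ n : ℕ, N ≤ n → 2 ≤ n → ∀ t,
      Real.exp (-(n / (2 * β)) * t ^ 2) * (∫ x, Real.exp (t * x) ∂ρ) ^ (n - 2) *
      (t ^ 2 * Real.exp (4 * a * t ^ 2)) ≤
      L * (t ^ 2 * Real.exp (-c * (n * t ^ (2 * k))) + t ^ 2 * Real.exp (-c * (n * t ^ 2))))
    (ε d : ℝ) (hε : 0 < ε) (hε1 : ε ≤ 1) (hd : 0 < d)
    (hlb : ∀ n : ℕ, 0 < n → ∀ t, n * t ^ (2 * k) ≤ ε →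
      d ≤ Real.exp (-(n / (2 * β)) * t ^ 2) * (∫ x, Real.exp (t * x) ∂ρ) ^ n) :
    ∃ C : ℝ, ∀ n : ℕ, N ≤ n → 0 < n → ∀ i j : Fin n, i < j →
      |∫ x, (x i ^ 2 - 1) * (x j ^ 2 - 1) ∂(cwMeasure ρ β n)| ≤
        C * (n : ℝ) ^ (-(1 / (k : ℝ))) := by
  set Ik := ∫ t : ℝ, t ^ 2 * Real.exp (-c * t ^ (2 * k)) with hIk
  set I1 := ∫ t : ℝ, t ^ 2 * Real.exp (-c * t ^ (2 * 1)) with hI1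
  have hI10 : 0 ≤ I1 := integral_nonneg fun t => by positivity
  refine ⟨(14 * D * Real.exp (2 * a)) ^ 2 * (L * (Ik + I1)) / (2 * ε * d), ?_⟩
  intro n hN hn i j hij
  have hn2 : 2 ≤ n := by
    have := j.isLt
    have h2 : i.val < j.val := hij
    omega
  have hn1 : (1:ℝ) ≤ n := by exact_mod_cast hn
  have hkpos : (0:ℝ) < k := by exact_mod_cast hk
  set r : ℝ := (n : ℝ) ^ (((2 * k : ℕ) : ℝ)⁻¹) with hr
  have hr1 : 1 ≤ r := Real.one_le_rpow hn1 (by positivity)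
  have hr0 : 0 < r := by linarith
  have hrn : r ^ (2 * k) = n := Real.rpow_inv_natCast_pow (by positivity) (by omega)
  have hr2 : (n : ℝ) ^ (-(1 / (k : ℝ))) = (r ^ 2)⁻¹ := by
    rw [Real.rpow_neg (by positivity), hr, ← Real.rpow_natCast, ← Real.rpow_mul (by positivity)]
    congr 2
    push_cast
    field_simp
  have hrk : r ≤ r ^ k := le_self_pow₀ hr1 (by omega)
  obtain ⟨p1, p2⟩ := cw_psi_scale k hk c hc r hr0
  obtain ⟨p3, p4⟩ := cw_psi_scale 1 le_rfl c hc (r ^ k) (by positivity)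
  have s1 : ∀ t : ℝ, (r * t) ^ (2 * k) = n * t ^ (2 * k) := by
    intro t
    rw [mul_pow, hrn]
  have s2 : ∀ t : ℝ, (r ^ k * t) ^ (2 * 1) = n * t ^ 2 := by
    intro t
    rw [mul_one, mul_pow, ← pow_mul, mul_comm k 2, hrn]
  simp_rw [s1] at p1 p2
  simp_rw [s2] at p3 p4
  have hmain := cw_ratio ρ hI hvar D a hD ha hM β hβ n hn i j hij (hq n hN)
    (fun t => L * (t ^ 2 * Real.exp (-c * (n * t ^ (2 * k))) +
      t ^ 2 * Real.exp (-c * (n * t ^ 2)))) ((p1.add p3).const_mul L) (hub n hN hn2)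
    (ε / r) d (by positivity) hd (by
      intro t ht
      apply hlb n hn t
      rw [← s1, pow_mul, ← sq_abs, ← pow_mul, abs_mul, abs_of_pos hr0]
      have h1 : r * |t| ≤ ε := by
        rw [le_div_iff₀ hr0] at ht
        linarith
      calc (r * |t|) ^ (2 * k) ≤ ε ^ (2 * k) := by gcongr
        _ ≤ ε := pow_le_of_le_one hε.le hε1 (by omega))
  rw [integral_const_mul, integral_add p1 p3, p2, p4] at hmain
  refine hmain.trans ?_
  rw [hr2]
  have h5 : ((r ^ k) ^ 3)⁻¹ * I1 ≤ (r ^ 3)⁻¹ * I1 := by gcongr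
  calc _ ≤ (14 * D * Real.exp (2 * a)) ^ 2 * (L * ((r ^ 3)⁻¹ * Ik + (r ^ 3)⁻¹ * I1)) /
        (2 * (ε / r) * d) := by
        gcongr
    _ = _ := by
        field_simp

lemma cw_case_one (ρ : Measure ℝ) [IsProbabilityMeasure ρ]
    (hI : ∀ t, Integrable (fun x => Real.exp (t * x)) ρ)
    (hmean : ∫ x, x ∂ρ = 0) (hvar : ∫ x, x ^ 2 ∂ρ = 1)
    (β b : ℝ) (hβ : 0 < β) (hb : β < b)
    (hM : ∀ t : ℝ, ∫ x, Real.exp (t * x) ∂ρ ≤ Real.exp (t ^ 2 / (2 * b))) :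
    ∃ (C : ℝ) (N : ℕ), ∀ n : ℕ, N ≤ n → 0 < n → ∀ i j : Fin n, i < j →
      |∫ x, (x i ^ 2 - 1) * (x j ^ 2 - 1) ∂(cwMeasure ρ β n)| ≤ C * (n : ℝ)⁻¹ := by
  have hb0 : 0 < b := hβ.trans hb
  set a : ℝ := 1 / (2 * b) with ha
  have ha0 : 0 < a := by positivity
  have hM' : ∀ t : ℝ, ∫ x, Real.exp (t * x) ∂ρ ≤ 1 * Real.exp (a * t ^ 2) := by
    intro t
    rw [one_mul]
    convert hM t using 2
    rw [ha]
    ring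
  have hM0 : ∀ t, 0 ≤ ∫ x, Real.exp (t * x) ∂ρ := fun t =>
    integral_nonneg fun _ => (Real.exp_pos _).le
  have hab : a < 1 / (2 * β) := by
    rw [ha]
    apply one_div_lt_one_div_of_lt <;> linarith
  set δ : ℝ := (1 / (2 * β) - a) / 2 with hδ
  have hδ0 : 0 < δ := by rw [hδ]; linarith
  obtain ⟨N, hN⟩ := exists_nat_gt (2 * a / δ)
  have hNn : ∀ n : ℕ, N ≤ n → 2 * a < δ * n := by
    intro n hn
    rw [div_lt_iff₀ hδ0] at hN
    have : (N : ℝ) ≤ n := by exact_mod_cast hn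
    nlinarith
  have hdiv : ∀ n : ℕ, (n : ℝ) / (2 * β) = (2 * δ + a) * n := by
    intro n
    rw [hδ]
    ring
  obtain ⟨C, hC⟩ := cw_final ρ hI hvar 1 a zero_le_one ha0.le hM' β hβ 1 le_rfl N
    (by
      intro n hn
      rw [hdiv]
      have := hNn n hn
      nlinarith)
    1 δ one_pos hδ0
    (by
      intro n hn hn2 t
      have h1 : (∫ x, Real.exp (t * x) ∂ρ) ^ (n - 2) ≤ Real.exp ((n - 2 : ℕ) * (a * t ^ 2)) := by
        rw [Real.exp_nat_mul]
        have := hM' t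
        rw [one_mul] at this
        exact pow_le_pow_left₀ (hM0 t) this _
      have h2 : Real.exp (-(n / (2 * β)) * t ^ 2) * Real.exp ((n - 2 : ℕ) * (a * t ^ 2)) *
          Real.exp (4 * a * t ^ 2) ≤ Real.exp (-δ * (n * t ^ 2)) := by
        rw [← Real.exp_add, ← Real.exp_add, Real.exp_le_exp, hdiv]
        push_cast [Nat.cast_sub hn2]
        have h3 : 2 * a * t ^ 2 ≤ δ * n * t ^ 2 :=
          mul_le_mul_of_nonneg_right (hNn n hn).le (sq_nonneg t)
        nlinarith
      calc _ ≤ Real.exp (-(n / (2 * β)) * t ^ 2) * Real.exp ((n - 2 : ℕ) * (a * t ^ 2)) *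
            (t ^ 2 * Real.exp (4 * a * t ^ 2)) := by gcongr
        _ = t ^ 2 * (Real.exp (-(n / (2 * β)) * t ^ 2) * Real.exp ((n - 2 : ℕ) * (a * t ^ 2)) *
          Real.exp (4 * a * t ^ 2)) := by ring
        _ ≤ t ^ 2 * Real.exp (-δ * (n * t ^ 2)) := by gcongr
        _ ≤ _ := by
          rw [one_mul, mul_one]
          have : 0 ≤ t ^ 2 * Real.exp (-δ * (n * t ^ 2)) := by positivity
          linarith)
    1 (Real.exp (-(1 / (2 * β)))) one_pos le_rfl (Real.exp_pos _)
    (by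
      intro n hn t ht
      rw [mul_one] at ht
      have h1 : 1 ≤ (∫ x, Real.exp (t * x) ∂ρ) ^ n :=
        one_le_pow₀ (cw_mgf_ge_one ρ hI hmean t)
      have h2 : Real.exp (-(1 / (2 * β))) ≤ Real.exp (-(n / (2 * β)) * t ^ 2) := by
        rw [Real.exp_le_exp]
        have : (n : ℝ) / (2 * β) * t ^ 2 = 1 / (2 * β) * (n * t ^ 2) := by ring
        have h3 : 1 / (2 * β) * (n * t ^ 2) ≤ 1 / (2 * β) * 1 := by gcongr
        linarith
      nlinarith [Real.exp_pos (-(n / (2 * β)) * t ^ 2)])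
  refine ⟨C, N, fun n hn hn0 i j hij => ?_⟩
  have := hC n hn hn0 i j hij
  simpa [Real.rpow_neg_one] using this

/-- Lower bound on the moment generating function from moment matching. -/
lemma cw_mgf_lower (ρ : Measure ℝ) [IsProbabilityMeasure ρ]
    (hI : ∀ t, Integrable (fun x => Real.exp (t * x)) ρ) (k : ℕ)
    (hmom : ∀ j : ℕ, j < 2 * k → (∫ x, x ^ j ∂(gaussianReal 0 1)) - ∫ x, x ^ j ∂ρ = 0) :
    ∃ C : ℝ, 1 ≤ C ∧ ∀ t : ℝ, |t| ≤ 1 →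
      Real.exp (t ^ 2 / 2) - C * t ^ (2 * k) ≤ ∫ x, Real.exp (t * x) ∂ρ := by
  have hG : ∀ t, Integrable (fun x => Real.exp (t * x)) (gaussianReal 0 1) := fun t =>
    integrable_exp_mul_gaussianReal t
  set A := ∫ x, |x| ^ (2 * k) * Real.exp (1 * |x|) ∂ρ with hA
  set B := ∫ x, |x| ^ (2 * k) * Real.exp (1 * |x|) ∂(gaussianReal 0 1) with hB
  have hA0 : 0 ≤ A := integral_nonneg fun t => by positivity
  have hB0 : 0 ≤ B := integral_nonneg fun t => by positivity
  refine ⟨A + B + 1, by linarith, fun t ht => ?_⟩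
  have h1 := cw_mgf_taylor ρ hI (2 * k) t ht
  have h2 := cw_mgf_taylor (gaussianReal 0 1) hG (2 * k) t ht
  have h3 : ∑ j ∈ Finset.range (2 * k), t ^ j / (j.factorial : ℝ) * ∫ x, x ^ j ∂(gaussianReal 0 1)
      = ∑ j ∈ Finset.range (2 * k), t ^ j / (j.factorial : ℝ) * ∫ x, x ^ j ∂ρ := by
    refine Finset.sum_congr rfl fun j hj => ?_
    have := hmom j (Finset.mem_range.1 hj)
    rw [sub_eq_zero.1 this]
  have h4 : ∫ x, Real.exp (t * x) ∂(gaussianReal 0 1) = Real.exp (t ^ 2 / 2) := by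
    have := congrFun (mgf_id_gaussianReal (μ := 0) (v := 1)) t
    simpa [mgf] using this
  rw [h3, h4, ← hB] at h2
  rw [← hA] at h1
  have h5 : |t| ^ (2 * k) = t ^ (2 * k) := by rw [pow_mul, sq_abs, ← pow_mul]
  rw [h5] at h1 h2
  have h6 : 0 ≤ t ^ (2 * k) := by rw [← h5]; positivity
  have h7 := (abs_le.1 h1).1
  have h8 := (abs_le.1 h2).2
  nlinarith

lemma cw_case_two (ρ : Measure ℝ) [IsProbabilityMeasure ρ]
    (hI : ∀ t, Integrable (fun x => Real.exp (t * x)) ρ)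
    (hmean : ∫ x, x ∂ρ = 0) (hvar : ∫ x, x ^ 2 ∂ρ = 1)
    (k : ℕ) (hk : 1 ≤ k)
    (hmom : ∀ j : ℕ, j < 2 * k → (∫ x, x ^ j ∂(gaussianReal 0 1)) - ∫ x, x ^ j ∂ρ = 0)
    (b₀ b₁ b₂ : ℝ) (hb₁ : 0 < b₁) (hb₂ : 1 < b₂)
    (hM1 : ∀ t : ℝ, |t| ≤ b₀ →
        ∫ x, Real.exp (t * x) ∂ρ ≤ Real.exp (t ^ 2 / 2 - b₁ * t ^ (2 * k)))
    (hM2 : ∀ t : ℝ, b₀ < |t| →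
        ∫ x, Real.exp (t * x) ∂ρ ≤ Real.exp (t ^ 2 / (2 * b₂))) :
    ∃ (C : ℝ) (N : ℕ), ∀ n : ℕ, N ≤ n → 0 < n → ∀ i j : Fin n, i < j →
      |∫ x, (x i ^ 2 - 1) * (x j ^ 2 - 1) ∂(cwMeasure ρ 1 n)| ≤
        C * (n : ℝ) ^ (-(1 / (k : ℝ))) := by
  have hb0 : 0 < b₂ := by linarith
  set a : ℝ := 1 / (2 * b₂) with ha
  have ha0 : 0 < a := by positivity
  have hM0 : ∀ t, 0 ≤ ∫ x, Real.exp (t * x) ∂ρ := fun t =>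
    integral_nonneg fun _ => (Real.exp_pos _).le
  have htk : ∀ t : ℝ, 0 ≤ t ^ (2 * k) := fun t => by rw [pow_mul]; positivity
  have hM2' : ∀ t : ℝ, b₀ < |t| → ∫ x, Real.exp (t * x) ∂ρ ≤ Real.exp (a * t ^ 2) := by
    intro t ht
    convert hM2 t ht using 2
    rw [ha]
    ring
  have hsq : ∀ t : ℝ, |t| ≤ b₀ → t ^ 2 ≤ b₀ ^ 2 := by
    intro t ht
    rw [← sq_abs]
    exact pow_le_pow_left₀ (abs_nonneg t) ht 2
  set D : ℝ := Real.exp (b₀ ^ 2 / 2) with hD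
  have hD1 : 1 ≤ D := Real.one_le_exp (by positivity)
  have hM' : ∀ t : ℝ, ∫ x, Real.exp (t * x) ∂ρ ≤ D * Real.exp (a * t ^ 2) := by
    intro t
    rcases le_or_gt |t| b₀ with ht | ht
    · refine (hM1 t ht).trans ?_
      rw [hD, ← Real.exp_add, Real.exp_le_exp]
      have h1 := hsq t ht
      have h2 := mul_nonneg hb₁.le (htk t)
      have h3 : 0 ≤ a * t ^ 2 := by positivity
      linarith
    · refine (hM2' t ht).trans ?_
      exact le_mul_of_one_le_left (Real.exp_pos _).le hD1
  have hab : a < 1 / 2 := by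
    rw [ha]
    apply one_div_lt_one_div_of_lt <;> linarith
  set δ : ℝ := (1 / 2 - a) / 2 with hδ
  have hδ0 : 0 < δ := by rw [hδ]; linarith
  obtain ⟨N, hN⟩ := exists_nat_gt (2 * a / δ)
  have hNn : ∀ n : ℕ, N ≤ n → 2 * a < δ * n := by
    intro n hn
    rw [div_lt_iff₀ hδ0] at hN
    have : (N : ℝ) ≤ n := by exact_mod_cast hn
    nlinarith
  have hdiv : ∀ n : ℕ, (n : ℝ) / (2 * 1) = (2 * δ + a) * n := by
    intro n
    rw [hδ]
    ring
  obtain ⟨A, hA1, hA⟩ := cw_mgf_lower ρ hI k hmom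
  have hA0 : 0 < A := by linarith
  set L : ℝ := Real.exp (4 * a * b₀ ^ 2) with hL
  have hL1 : 1 ≤ L := Real.one_le_exp (by positivity)
  set c : ℝ := min b₁ δ with hc
  have hc0 : 0 < c := lt_min hb₁ hδ0
  obtain ⟨C, hC⟩ := cw_final ρ hI hvar D a (by linarith) ha0.le hM' 1 one_pos k hk N
    (by
      intro n hn
      rw [hdiv]
      have := hNn n hn
      nlinarith)
    L c (by linarith) hc0
    (by
      intro n hn hn2 t
      rcases le_or_gt |t| b₀ with ht | ht
      · have h1 : (∫ x, Real.exp (t * x) ∂ρ) ^ (n - 2) ≤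
            Real.exp (n * (t ^ 2 / 2 - b₁ * t ^ (2 * k))) := by
          rw [Real.exp_nat_mul]
          calc _ ≤ (∫ x, Real.exp (t * x) ∂ρ) ^ n :=
                pow_le_pow_right₀ (cw_mgf_ge_one ρ hI hmean t) (by omega)
            _ ≤ _ := pow_le_pow_left₀ (hM0 t) (hM1 t ht) n
        have h2 : Real.exp (-(n / (2 * 1)) * t ^ 2) *
            Real.exp (n * (t ^ 2 / 2 - b₁ * t ^ (2 * k))) ≤ Real.exp (-c * (n * t ^ (2 * k))) := by
          rw [← Real.exp_add, Real.exp_le_exp]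
          have h3 : c * (n * t ^ (2 * k)) ≤ b₁ * (n * t ^ (2 * k)) :=
            mul_le_mul_of_nonneg_right (min_le_left _ _) (mul_nonneg (Nat.cast_nonneg n) (htk t))
          nlinarith
        have h4 : Real.exp (4 * a * t ^ 2) ≤ L := by
          rw [hL, Real.exp_le_exp]
          have := hsq t ht
          gcongr
        calc _ ≤ Real.exp (-(n / (2 * 1)) * t ^ 2) *
              Real.exp (n * (t ^ 2 / 2 - b₁ * t ^ (2 * k))) * (t ^ 2 * L) := by gcongr
          _ ≤ Real.exp (-c * (n * t ^ (2 * k))) * (t ^ 2 * L) := by gcongr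
          _ = L * (t ^ 2 * Real.exp (-c * (n * t ^ (2 * k)))) := by ring
          _ ≤ _ := by
            gcongr
            have : 0 ≤ t ^ 2 * Real.exp (-c * (n * t ^ 2)) := by positivity
            linarith
      · have h1 : (∫ x, Real.exp (t * x) ∂ρ) ^ (n - 2) ≤
            Real.exp ((n - 2 : ℕ) * (a * t ^ 2)) := by
          rw [Real.exp_nat_mul]
          exact pow_le_pow_left₀ (hM0 t) (hM2' t ht) _
        have h2 : Real.exp (-(n / (2 * 1)) * t ^ 2) * Real.exp ((n - 2 : ℕ) * (a * t ^ 2)) *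
            Real.exp (4 * a * t ^ 2) ≤ Real.exp (-c * (n * t ^ 2)) := by
          rw [← Real.exp_add, ← Real.exp_add, Real.exp_le_exp, hdiv]
          push_cast [Nat.cast_sub hn2]
          have h3 : 2 * a * t ^ 2 ≤ δ * n * t ^ 2 :=
            mul_le_mul_of_nonneg_right (hNn n hn).le (sq_nonneg t)
          have h4 : c * (n * t ^ 2) ≤ δ * (n * t ^ 2) :=
            mul_le_mul_of_nonneg_right (min_le_right _ _) (by positivity)
          nlinarith
        calc _ ≤ Real.exp (-(n / (2 * 1)) * t ^ 2) * Real.exp ((n - 2 : ℕ) * (a * t ^ 2)) *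
              (t ^ 2 * Real.exp (4 * a * t ^ 2)) := by gcongr
          _ = t ^ 2 * (Real.exp (-(n / (2 * 1)) * t ^ 2) *
            Real.exp ((n - 2 : ℕ) * (a * t ^ 2)) * Real.exp (4 * a * t ^ 2)) := by ring
          _ ≤ 1 * (t ^ 2 * Real.exp (-c * (n * t ^ 2))) := by rw [one_mul]; gcongr
          _ ≤ _ := by
            gcongr
            have : 0 ≤ t ^ 2 * Real.exp (-c * (n * t ^ (2 * k))) := by positivity
            linarith)
    (1 / (2 * A)) (1 / 2) (by positivity)
    (by rw [div_le_one (by positivity)]; linarith) (by norm_num)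
    (by
      intro n hn t ht
      have hn1 : (1:ℝ) ≤ n := by exact_mod_cast hn
      have h1 : t ^ (2 * k) ≤ 1 / (2 * A) := by nlinarith [htk t]
      have h2 : 1 / (2 * A) ≤ 1 := by rw [div_le_one (by positivity)]; linarith
      have h3 : |t| ≤ 1 := by
        by_contra hcon
        push Not at hcon
        have h4 : 1 < |t| ^ (2 * k) := one_lt_pow₀ hcon (by omega)
        have h5 : |t| ^ (2 * k) = t ^ (2 * k) := by rw [pow_mul, sq_abs, ← pow_mul]
        linarith
      have h6 := hA t h3
      have h7 : A * (n * t ^ (2 * k)) ≤ 1 / 2 := by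
        calc A * (n * t ^ (2 * k)) ≤ A * (1 / (2 * A)) := by gcongr
          _ = 1 / 2 := by field_simp
      have h8 : A * t ^ (2 * k) ≤ 1 / 2 := by
        calc A * t ^ (2 * k) ≤ A * (1 / (2 * A)) := by gcongr
          _ = 1 / 2 := by field_simp
      have h9 : 1 + -(A * t ^ (2 * k)) ≤ Real.exp (-(t ^ 2 / 2)) * ∫ x, Real.exp (t * x) ∂ρ := by
        have e1 : Real.exp (-(t ^ 2 / 2)) * Real.exp (t ^ 2 / 2) = 1 := by
          rw [← Real.exp_add]; simp
        have e2 : Real.exp (-(t ^ 2 / 2)) ≤ 1 := Real.exp_le_one_iff.2 (by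
          have := sq_nonneg t
          linarith)
        have e3 := mul_le_mul_of_nonneg_left h6 (Real.exp_pos (-(t ^ 2 / 2))).le
        have e4 : Real.exp (-(t ^ 2 / 2)) * (A * t ^ (2 * k)) ≤ 1 * (A * t ^ (2 * k)) :=
          mul_le_mul_of_nonneg_right e2 (mul_nonneg hA0.le (htk t))
        rw [mul_sub, e1] at e3
        linarith
      have h10 := one_add_mul_le_pow (a := -(A * t ^ (2 * k))) (by linarith) n
      have h11 : (1 + -(A * t ^ (2 * k))) ^ n ≤
          (Real.exp (-(t ^ 2 / 2)) * ∫ x, Real.exp (t * x) ∂ρ) ^ n :=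
        pow_le_pow_left₀ (by linarith) h9 n
      rw [mul_pow, ← Real.exp_nat_mul] at h11
      have h12 : (n : ℝ) * -(t ^ 2 / 2) = -(n / (2 * 1)) * t ^ 2 := by ring
      rw [h12] at h11
      nlinarith)
  exact ⟨C, N, hC⟩

/-- Lemma 5.7, pairwise covariance bounds for the Curie–Weiss model.
For `1 ≤ i < j ≤ n`: (i) if `0 < β < 1` under the subcritical mgf bound,
`|E (Xᵢ² - 1)(Xⱼ² - 1)| ≤ C n⁻¹`; (ii) if `β = 1`, `ρ` of type `k` under the critical
mgf bounds, `|E (Xᵢ² - 1)(Xⱼ² - 1)| ≤ C n^{-1/k}`; `C` does not depend on `n, i, j`. -/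
theorem curie_weiss_square_covariance_bounds
    (ρ : Measure ℝ) [IsProbabilityMeasure ρ]
    (hmean : ∫ x, x ∂ρ = 0) (hvar : ∫ x, x ^ 2 ∂ρ = 1) :
    (∀ β b : ℝ, 0 < β → β < 1 → β < b →
      (∀ t : ℝ, ∫ x, Real.exp (t * x) ∂ρ ≤ Real.exp (t ^ 2 / (2 * b))) →
      ∃ C : ℝ, 0 < C ∧
        ∀ n : ℕ, 0 < n → ∀ i j : Fin n, i < j →
          |∫ x, (x i ^ 2 - 1) * (x j ^ 2 - 1) ∂(cwMeasure ρ β n)| ≤ C * (n : ℝ)⁻¹) ∧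
    (∀ (k : ℕ), 1 ≤ k → ∀ lamρ : ℝ, 0 < lamρ →
      (∀ j : ℕ, j < 2 * k →
        (∫ x, x ^ j ∂(ProbabilityTheory.gaussianReal 0 1)) - ∫ x, x ^ j ∂ρ = 0) →
      ((∫ x, x ^ (2 * k) ∂(ProbabilityTheory.gaussianReal 0 1)) -
        ∫ x, x ^ (2 * k) ∂ρ = lamρ) →
      ∀ b₀ b₁ b₂ : ℝ, 0 < b₀ → 0 < b₁ → 1 < b₂ →
      (∀ t : ℝ, |t| ≤ b₀ →
        ∫ x, Real.exp (t * x) ∂ρ ≤ Real.exp (t ^ 2 / 2 - b₁ * t ^ (2 * k))) →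
      (∀ t : ℝ, b₀ < |t| →
        ∫ x, Real.exp (t * x) ∂ρ ≤ Real.exp (t ^ 2 / (2 * b₂))) →
      ∃ C : ℝ, 0 < C ∧
        ∀ n : ℕ, 0 < n → ∀ i j : Fin n, i < j →
          |∫ x, (x i ^ 2 - 1) * (x j ^ 2 - 1) ∂(cwMeasure ρ 1 n)| ≤
            C * (n : ℝ) ^ (-(1 / (k : ℝ)))) := by
  constructor
  · intro β b hβ _ hb hM
    by_cases hI : ∀ t, Integrable (fun x => Real.exp (t * x)) ρ
    · obtain ⟨C, N, hC⟩ := cw_case_one ρ hI hmean hvar β b hβ hb hM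
      exact cw_finite (fun n i j => ∫ x, (x i ^ 2 - 1) * (x j ^ 2 - 1) ∂(cwMeasure ρ β n))
        (fun n => (n : ℝ)⁻¹) (fun n hn => by positivity) C N hC
    · push Not at hI
      obtain ⟨t, ht⟩ := hI
      refine ⟨1, one_pos, fun n hn i j _ => ?_⟩
      rw [cw_zero ρ β hβ t ht n hn]
      simp
  · intro k hk lamρ _ hmom _ b₀ b₁ b₂ _ hb₁ hb₂ hM1 hM2
    by_cases hI : ∀ t, Integrable (fun x => Real.exp (t * x)) ρ
    · obtain ⟨C, N, hC⟩ := cw_case_two ρ hI hmean hvar k hk hmom b₀ b₁ b₂ hb₁ hb₂ hM1 hM2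
      exact cw_finite (fun n i j => ∫ x, (x i ^ 2 - 1) * (x j ^ 2 - 1) ∂(cwMeasure ρ 1 n))
        (fun n => (n : ℝ) ^ (-(1 / (k : ℝ)))) (fun n hn => by positivity) C N hC
    · push Not at hI
      obtain ⟨t, ht⟩ := hI
      refine ⟨1, one_pos, fun n hn i j _ => ?_⟩
      rw [cw_zero ρ 1 one_pos t ht n hn]
      simp
      positivity
end
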